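/- arXiv:1412.5569 — 2 statements merged into one kernel-verified Lean document; each statement's English description precedes it below -/
import Mathlib

section
/- Let d ≥ 1 be an integer. There exists a constant c > 0 depending only on d such that the following holds: for every finite field F, every integer n ≥ 1, every real number β with 0 ≤ β ≤ 1, and every collection L of lines in F^n with |L| ≥ |F|^{2(d-1)+β}, the union of the lines in L satisfies |⋃_{ℓ ∈ L} ℓ| ≥ c · |F|^{d+β}. -/
open scoped Pointwise

/-- `A` is a `k`-plane (i.e. a `k`-dimensional affine subspace) of the `F`-vector space `V`. -/
def IsPlane (F : Type*) [Field F] {V : Type*} [AddCommGroup V] [Module F V]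
    (k : ℕ) (A : Set V) : Prop :=
  ∃ (x : V) (W : Submodule F V), Module.finrank F W = k ∧ A = x +ᵥ (W : Set V)

section Planes

variable {F : Type*} [Field F] {V : Type*} [AddCommGroup V] [Module F V]

lemma mem_vadd_submodule_iff {x p : V} {W : Submodule F V} :
    p ∈ x +ᵥ (W : Set V) ↔ p - x ∈ W := by
  rw [Set.mem_vadd_set_iff_neg_vadd_mem, vadd_eq_add, neg_add_eq_sub, SetLike.mem_coe]

lemma IsPlane.ncard_eq [Fintype F] [Finite V] {k : ℕ} {A : Set V} (hA : IsPlane F k A) :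
    A.ncard = Fintype.card F ^ k := by
  obtain ⟨x, W, hW, rfl⟩ := hA
  rw [← hW, ← Nat.card_eq_fintype_card, ← Module.natCard_eq_pow_finrank (K := F) (V := W),
    Set.ncard_vadd_set]
  rfl

/-- A plane contains the line through any two of its points. -/
lemma IsPlane.add_smul_sub_mem {k : ℕ} {A : Set V} (hA : IsPlane F k A) {p p' : V}
    (hp : p ∈ A) (hp' : p' ∈ A) (t : F) : p + t • (p' - p) ∈ A := by
  obtain ⟨x, W, -, rfl⟩ := hA
  rw [mem_vadd_submodule_iff] at *
  have h : p + t • (p' - p) - x = (p - x) + t • ((p' - x) - (p - x)) := by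
    rw [sub_sub_sub_cancel_right]; abel
  rw [h]
  exact W.add_mem hp (W.smul_mem _ (W.sub_mem hp' hp))

/-- Every point of a line is an affine combination of two given distinct points. -/
lemma IsPlane.exists_eq_add_smul_sub {ℓ : Set V} (hℓ : IsPlane F 1 ℓ) {p p' y : V}
    (hp : p ∈ ℓ) (hp' : p' ∈ ℓ) (hne : p' ≠ p) (hy : y ∈ ℓ) :
    ∃ t : F, y = p + t • (p' - p) := by
  obtain ⟨x, W, hW, rfl⟩ := hℓ
  rw [mem_vadd_submodule_iff] at *
  have h1 : p' - p ∈ W := by simpa using W.sub_mem hp' hp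
  have h2 : y - p ∈ W := by simpa using W.sub_mem hy hp
  obtain ⟨t, ht⟩ := (finrank_eq_one_iff_of_nonzero' (⟨p' - p, h1⟩ : W)
    (by simpa [Subtype.ext_iff, sub_eq_zero] using hne)).1 hW ⟨y - p, h2⟩
  refine ⟨t, ?_⟩
  have h3 : t • (p' - p) = y - p := congrArg Subtype.val ht
  rw [h3]; abel

lemma IsPlane.subset_of_mem {k : ℕ} {ℓ A : Set V} (hℓ : IsPlane F 1 ℓ) (hA : IsPlane F k A)
    {p p' : V} (hp : p ∈ ℓ) (hp' : p' ∈ ℓ) (hne : p' ≠ p) (hpA : p ∈ A) (hpA' : p' ∈ A) :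
    ℓ ⊆ A := by
  intro y hy
  obtain ⟨t, rfl⟩ := hℓ.exists_eq_add_smul_sub hp hp' hne hy
  exact hA.add_smul_sub_mem hpA hpA' t

lemma IsPlane.ncard_inter_le [Fintype F] [Finite V] {k : ℕ} {A B : Set V}
    (hA : IsPlane F (k + 1) A) (hB : IsPlane F (k + 1) B) (hne : A ≠ B) :
    (A ∩ B).ncard ≤ Fintype.card F ^ k := by
  obtain ⟨x, W, hW, rfl⟩ := hA
  obtain ⟨y, U, hU, rfl⟩ := hB
  rcases ((x +ᵥ (W : Set V)) ∩ (y +ᵥ (U : Set V))).eq_empty_or_nonempty with h | ⟨z, hz, hz'⟩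
  · simp [h]
  have key : ∀ {x : V} {W : Submodule F V}, z ∈ x +ᵥ (W : Set V) →
      x +ᵥ (W : Set V) = z +ᵥ (W : Set V) := by
    intro x W h
    rw [mem_vadd_submodule_iff] at h
    ext p
    rw [mem_vadd_submodule_iff, mem_vadd_submodule_iff, ← W.sub_mem_iff_left h,
      sub_sub_sub_cancel_right]
  rw [key hz, key hz'] at hne ⊢
  have hWU : W ≠ U := fun h => hne (by rw [h])
  have hlt : Module.finrank F (W ⊓ U : Submodule F V) ≤ k := by
    have : W ⊓ U < W := by
      refine lt_of_le_of_ne inf_le_left fun h => hWU ?_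
      exact Submodule.eq_of_le_of_finrank_eq (inf_eq_left.1 h) (hW.trans hU.symm)
    have := Submodule.finrank_lt_finrank_of_lt this
    omega
  have hplane : IsPlane F _ (z +ᵥ ((W ⊓ U : Submodule F V) : Set V)) := ⟨z, W ⊓ U, rfl, rfl⟩
  have hint : (z +ᵥ (W : Set V)) ∩ (z +ᵥ (U : Set V)) = z +ᵥ ((W ⊓ U : Submodule F V) : Set V) := by
    ext p
    simp only [Set.mem_inter_iff, mem_vadd_submodule_iff, Submodule.mem_inf]
  rw [hint, hplane.ncard_eq]
  exact Nat.pow_le_pow_right Fintype.card_pos hlt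

end Planes

section Incidences

open Finset
open scoped Classical

lemma card_filter_mem_le_ncard {α : Type*} [Finite α] (P : Finset α) (A : Set α)
    [DecidablePred (· ∈ A)] : #{p ∈ P | p ∈ A} ≤ A.ncard := by
  rw [← Set.ncard_coe_finset]
  exact Set.ncard_le_ncard (fun x hx => by simp at hx; exact hx.2) (Set.toFinite _)

/-- A bipartite incidence structure in which each `ℓ ∈ L` meets at least `a` points contains a
nonempty substructure with lower bounds on the degrees on both sides. -/
lemma exists_subsets_degrees_ge {α : Type*} (L : Finset (Set α)) (P : Finset α) (a b : ℝ)
    (hb : 0 ≤ b) (hL : ∀ ℓ ∈ L, a ≤ #{p ∈ P | p ∈ ℓ})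
    (hlt : b * #P < a / 2 * #L) :
    ∃ L' ⊆ L, ∃ P' ⊆ P, L'.Nonempty ∧ (∀ ℓ ∈ L', a / 2 ≤ #{p ∈ P' | p ∈ ℓ}) ∧
      ∀ p ∈ P', b ≤ #{ℓ ∈ L' | p ∈ ℓ} := by
  let f : Finset (Set α) × Finset α → ℝ := fun X =>
    ∑ ℓ ∈ X.1, (#{p ∈ X.2 | p ∈ ℓ} : ℝ) - a / 2 * #X.1 - b * #X.2
  have hf : ∀ X, f X = ∑ p ∈ X.2, (#{ℓ ∈ X.1 | p ∈ ℓ} : ℝ) - a / 2 * #X.1 - b * #X.2 := by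
    intro X
    have := sum_card_bipartiteAbove_eq_sum_card_bipartiteBelow (s := X.1) (t := X.2)
      (fun ℓ p => p ∈ ℓ)
    simp only [bipartiteAbove, bipartiteBelow] at this
    simp only [f]
    rw [← Nat.cast_sum, this, Nat.cast_sum]
  obtain ⟨X, hX, hmax⟩ := exists_max_image (L.powerset ×ˢ P.powerset) f
    ⟨(L, P), by simp⟩
  have hpos : 0 < f X := by
    refine lt_of_lt_of_le ?_ (hmax (L, P) (by simp))
    have : #L * a ≤ ∑ ℓ ∈ L, (#{p ∈ P | p ∈ ℓ} : ℝ) := by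
      rw [← nsmul_eq_mul]; exact card_nsmul_le_sum _ _ _ hL
    simp only [f]
    linarith
  simp only [mem_product, mem_powerset] at hX hmax
  refine ⟨X.1, hX.1, X.2, hX.2, ?_, fun ℓ hℓ => ?_, fun p hp => ?_⟩
  · rw [nonempty_iff_ne_empty]
    intro h
    simp only [f, h] at hpos
    simp at hpos
    have : 0 ≤ b * #X.2 := by positivity
    linarith
  · have h1 := hmax (X.1.erase ℓ, X.2) ⟨(erase_subset _ _).trans hX.1, hX.2⟩
    simp only [f] at h1
    rw [← add_sum_erase _ _ hℓ, card_erase_of_mem hℓ,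
      Nat.cast_sub (card_pos.2 ⟨ℓ, hℓ⟩)] at h1
    push_cast at h1
    linarith
  · have h1 := hmax (X.1, X.2.erase p) ⟨hX.1, (erase_subset _ _).trans hX.2⟩
    rw [hf, hf] at h1
    simp only at h1
    rw [← add_sum_erase _ _ hp, card_erase_of_mem hp,
      Nat.cast_sub (card_pos.2 ⟨p, hp⟩)] at h1
    push_cast at h1
    linarith

/-- A family of sets each meeting `P` in at least `a` points, with pairwise intersections of size
at most `b`, forces `P` to be large. -/
lemma card_mul_sub_le_card {α : Type*} [Finite α] (P : Finset α) (a b : ℝ) (hb : 0 ≤ b)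
    (S : Finset (Set α)) (hS : ∀ A ∈ S, a ≤ #{p ∈ P | p ∈ A})
    (hSS : ∀ A ∈ S, ∀ B ∈ S, A ≠ B → ((A ∩ B).ncard : ℝ) ≤ b) :
    #S * (a - #S * b) ≤ #P := by
  suffices h : #S * (a - #S * b) ≤ #{p ∈ P | ∃ A ∈ S, p ∈ A} from
    h.trans (by exact_mod_cast card_filter_le _ _)
  induction S using Finset.induction_on with
  | empty => simp
  | insert B S hB ih =>
    have ih := ih (fun A hA => hS A (mem_insert_of_mem hA))
      (fun A hA A' hA' => hSS A (mem_insert_of_mem hA) A' (mem_insert_of_mem hA'))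
    have hcover : ({p ∈ P | p ∈ B} : Finset α) ⊆
        (({p ∈ P | ∃ A ∈ insert B S, p ∈ A} : Finset α) \ {p ∈ P | ∃ A ∈ S, p ∈ A}) ∪
          S.biUnion fun A => {p ∈ P | p ∈ A ∩ B} := by
      intro p hp
      simp only [mem_filter, mem_union, mem_sdiff, mem_biUnion, mem_insert,
        Set.mem_inter_iff] at hp ⊢
      by_cases h : ∃ A ∈ S, p ∈ A
      · obtain ⟨A, hA, hpA⟩ := h
        exact Or.inr ⟨A, hA, hp.1, hpA, hp.2⟩
      · exact Or.inl ⟨⟨hp.1, B, Or.inl rfl, hp.2⟩, fun h' => h h'.2⟩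
    have h1 := (card_le_card hcover).trans (card_union_le _ _)
    have h2 : ((S.biUnion fun A => {p ∈ P | p ∈ A ∩ B}).card : ℝ) ≤ #S * b := by
      refine ((Nat.cast_le (α := ℝ)).2 card_biUnion_le).trans ?_
      rw [Nat.cast_sum, ← nsmul_eq_mul]
      refine sum_le_card_nsmul _ _ _ fun A hA => ?_
      refine (Nat.cast_le.2 (card_filter_mem_le_ncard P (A ∩ B))).trans ?_
      exact hSS A (mem_insert_of_mem hA) B (mem_insert_self _ _) fun h => hB (h ▸ hA)
    have h3 : ({p ∈ P | ∃ A ∈ S, p ∈ A} : Finset α) ⊆ {p ∈ P | ∃ A ∈ insert B S, p ∈ A} :=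
      monotone_filter_right _ fun p _ ⟨A, hA, hp⟩ => ⟨A, mem_insert_of_mem hA, hp⟩
    have h4 := card_sdiff_add_card_eq_card h3
    have h5 := hS B (mem_insert_self _ _)
    rw [card_insert_of_notMem hB]
    have h1' : (#{p ∈ P | p ∈ B} : ℝ) ≤ #(({p ∈ P | ∃ A ∈ insert B S, p ∈ A} : Finset α) \
        {p ∈ P | ∃ A ∈ S, p ∈ A}) + #(S.biUnion fun A => {p ∈ P | p ∈ A ∩ B}) := by
      exact_mod_cast h1
    have h4' : (#(({p ∈ P | ∃ A ∈ insert B S, p ∈ A} : Finset α) \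
        {p ∈ P | ∃ A ∈ S, p ∈ A}) : ℝ) + #{p ∈ P | ∃ A ∈ S, p ∈ A} =
          #{p ∈ P | ∃ A ∈ insert B S, p ∈ A} := by
      exact_mod_cast h4
    push_cast
    have h6 : 0 ≤ #S * b := by positivity
    nlinarith

section Field

variable {F : Type} [Field F] [Fintype F] {V : Type} [AddCommGroup V] [Module F V] [Finite V]

lemma card_lines_through_le {k : ℕ} {A : Set V} (hA : IsPlane F (k + 1) A) (p : V)
    (L : Finset (Set V)) (hL : ∀ ℓ ∈ L, IsPlane F 1 ℓ) (hp : ∀ ℓ ∈ L, p ∈ ℓ)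
    (hLA : ∀ ℓ ∈ L, ℓ ⊆ A) : #L ≤ 2 * Fintype.card F ^ k := by
  have hq : 1 < Fintype.card F := Fintype.one_lt_card
  have h := card_mul_le_card_mul (s := L) (t := A.toFinite.toFinset.erase p) (m := Fintype.card F - 1)
    (n := 1) (fun ℓ x => x ∈ ℓ) ?_ ?_
  · have h1 : #(A.toFinite.toFinset.erase p) ≤ Fintype.card F ^ (k + 1) := by
      rw [← hA.ncard_eq, Set.ncard_eq_toFinset_card A]
      exact card_le_card (erase_subset _ _)
    obtain ⟨r, hr⟩ : ∃ r, Fintype.card F = r + 2 := ⟨Fintype.card F - 2, by omega⟩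
    rw [hr] at h h1 ⊢
    have h2 : #L * (r + 1) ≤ (r + 2) ^ k * (r + 2) := by
      rw [← pow_succ]; simpa using h.trans (by simpa using h1)
    have h3 : #L * (r + 1) ≤ (2 * (r + 2) ^ k) * (r + 1) := by nlinarith [Nat.zero_le ((r+2)^k * r)]
    exact Nat.le_of_mul_le_mul_right h3 (Nat.succ_pos r)
  · intro ℓ hℓ
    have h1 : bipartiteAbove (fun (ℓ : Set V) x => x ∈ ℓ) (A.toFinite.toFinset.erase p) ℓ
        = ℓ.toFinite.toFinset.erase p := by
      ext x
      simp only [mem_bipartiteAbove, mem_erase, Set.Finite.mem_toFinset]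
      exact ⟨fun h => ⟨h.1.1, h.2⟩, fun h => ⟨⟨h.1, hLA ℓ hℓ h.2⟩, h.2⟩⟩
    rw [h1, card_erase_of_mem (by simpa using hp ℓ hℓ), ← Set.ncard_eq_toFinset_card,
      (hL ℓ hℓ).ncard_eq, pow_one]
  · intro x hx
    rw [card_le_one]
    intro ℓ hℓ ℓ' hℓ'
    simp only [mem_bipartiteBelow, mem_erase] at hℓ hℓ' hx
    exact Set.Subset.antisymm
      ((hL ℓ hℓ.1).subset_of_mem (hL ℓ' hℓ'.1) (hp _ hℓ.1) hℓ.2 hx.1 (hp _ hℓ'.1) hℓ'.2)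
      ((hL ℓ' hℓ'.1).subset_of_mem (hL ℓ hℓ.1) (hp _ hℓ'.1) hℓ'.2 hx.1 (hp _ hℓ.1) hℓ.2)

/-- Most lines through a point of a plane leave the plane. -/
lemma card_lines_not_subset_ge {k e : ℕ} (hke : k ≤ e) {A : Set V} (hA : IsPlane F (k + 1) A)
    {p : V} (L : Finset (Set V)) (hL : ∀ ℓ ∈ L, IsPlane F 1 ℓ)
    (hp : 4 * Fintype.card F ^ e ≤ #{ℓ ∈ L | p ∈ ℓ}) :
    2 * Fintype.card F ^ e ≤ #{ℓ ∈ L | p ∈ ℓ ∧ ¬ ℓ ⊆ A} := by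
  have h1 := card_lines_through_le hA p {ℓ ∈ L | p ∈ ℓ ∧ ℓ ⊆ A}
    (fun ℓ hℓ => hL ℓ (mem_filter.1 hℓ).1) (fun ℓ hℓ => (mem_filter.1 hℓ).2.1)
    (fun ℓ hℓ => (mem_filter.1 hℓ).2.2)
  have h2 := card_filter_add_card_filter_not (s := {ℓ ∈ L | p ∈ ℓ}) (fun ℓ => ℓ ⊆ A)
  rw [filter_filter, filter_filter] at h2
  have h3 : Fintype.card F ^ k ≤ Fintype.card F ^ e := Nat.pow_le_pow_right Fintype.card_pos hke
  omega

end Field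

/-- The incidence bound for lines meeting a set in a proportion at least `δ` of their points. -/
def ShadedLineBound (d : ℕ) : Prop :=
  ∀ δ : ℝ, 0 < δ → ∃ c : ℝ, 0 < c ∧
    ∀ (F : Type) [Field F] [Fintype F] (V : Type) [AddCommGroup V] [Module F V] [Finite V]
      (L : Finset (Set V)) (P : Finset V), (∀ ℓ ∈ L, IsPlane F 1 ℓ) →
      (∀ ℓ ∈ L, δ * Fintype.card F ≤ #{p ∈ P | p ∈ ℓ}) →
      c * #L * (Fintype.card F : ℝ) ^ 2 ≤ #P * (Fintype.card F : ℝ) ^ d ∨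
        c * (Fintype.card F : ℝ) ^ (d + 1) ≤ #P

/-- The hairbrush argument: a plane of dimension `k + 1` that is rich in points of `P` extends to a
rich plane of dimension `k + 2`, unless `P` is large. -/
lemma ShadedLineBound.exists_plane_succ {k e : ℕ} (hk : ShadedLineBound (k + 1)) (hke : k ≤ e)
    {δ η : ℝ} (hδ : 0 < δ) (hη : 0 < η) :
    ∃ c : ℝ, 0 < c ∧
    ∀ (F : Type) [Field F] [Fintype F] (V : Type) [AddCommGroup V] [Module F V] [Finite V]
      (L : Finset (Set V)) (P : Finset V), (∀ ℓ ∈ L, IsPlane F 1 ℓ) →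
      (∀ ℓ ∈ L, δ * Fintype.card F ≤ #{p ∈ P | p ∈ ℓ}) →
      (∀ p ∈ P, 4 * Fintype.card F ^ e ≤ #{ℓ ∈ L | p ∈ ℓ}) →
      2 ≤ δ * Fintype.card F →
      ∀ A : Set V, IsPlane F (k + 1) A →
        η * (Fintype.card F : ℝ) ^ (k + 1) ≤ #{p ∈ P | p ∈ A} →
      c * (Fintype.card F : ℝ) ^ (e + 2) ≤ #P ∨
        ∃ B : Set V, A ⊆ B ∧ IsPlane F (k + 2) B ∧
          c * (Fintype.card F : ℝ) ^ (k + 2) ≤ #{p ∈ P | p ∈ B} := by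
  obtain ⟨c, hc, h⟩ := hk (δ / 2) (by positivity)
  refine ⟨min c (2 * c * η), by positivity, ?_⟩
  intro F _ _ V _ _ _ L P hL hLP hPL hq A hA hAP
  have hA' := hA
  obtain ⟨x₀, W, hW, rfl⟩ := hA'
  set A : Set V := x₀ +ᵥ (W : Set V) with hAdef
  have hmemA : ∀ x, x ∈ A ↔ x - x₀ ∈ W := fun x => mem_vadd_submodule_iff
  have hq0 : (0 : ℝ) < Fintype.card F := by exact_mod_cast Fintype.card_pos
  let H : Finset (Set V) := {ℓ ∈ L | ¬ ℓ ⊆ A ∧ ∃ p ∈ ℓ, p ∈ A}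
  have hHL : ∀ ℓ ∈ H, ℓ ∈ L := fun ℓ hℓ => (mem_filter.1 hℓ).1
  have hHone : ∀ ℓ ∈ H, ∀ x ∈ ℓ, ∀ y ∈ ℓ, x ∈ A → y ∈ A → x = y := by
    intro ℓ hℓ x hx y hy hxA hyA
    by_contra hne
    exact (mem_filter.1 hℓ).2.1 ((hL ℓ (hHL ℓ hℓ)).subset_of_mem hA hy hx hne hyA hxA)
  have hHcard : #{p ∈ P | p ∈ A} * (2 * Fintype.card F ^ e) ≤ #H := by
    have := card_mul_le_card_mul (s := {p ∈ P | p ∈ A}) (t := H) (m := 2 * Fintype.card F ^ e)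
      (n := 1) (fun p ℓ => p ∈ ℓ) ?_ ?_
    · simpa using this
    · intro p hp
      rw [mem_filter] at hp
      refine (card_lines_not_subset_ge hke hA L hL (hPL p hp.1)).trans (card_le_card ?_)
      intro ℓ hℓ
      simp only [mem_filter, mem_bipartiteAbove, H] at hℓ ⊢
      exact ⟨⟨hℓ.1, hℓ.2.2, p, hℓ.2.1, hp.2⟩, hℓ.2.1⟩
    · intro ℓ hℓ
      rw [card_le_one]
      intro x hx y hy
      simp only [mem_bipartiteBelow, mem_filter] at hx hy
      exact hHone ℓ hℓ x hx.2 y hy.2 hx.1.2 hy.1.2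
  let g : V → Submodule F V := fun x => W ⊔ Submodule.span F {x - x₀}
  let h' : Set V → Submodule F V := fun ℓ => W ⊔ Submodule.span F ((fun x => x - x₀) '' ℓ)
  have hgh : ∀ ℓ ∈ H, ∀ x ∈ ℓ, x ∉ A → g x = h' ℓ := by
    intro ℓ hℓ x hx hxA
    apply le_antisymm
    · refine sup_le_sup_left (Submodule.span_mono ?_) _
      exact Set.singleton_subset_iff.2 ⟨x, hx, rfl⟩
    · refine sup_le le_sup_left (Submodule.span_le.2 ?_)
      rintro _ ⟨y, hy, rfl⟩
      obtain ⟨p, hp, hpA⟩ := (mem_filter.1 hℓ).2.2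
      obtain ⟨t, rfl⟩ := (hL ℓ (hHL ℓ hℓ)).exists_eq_add_smul_sub hp hx
        (fun h => hxA (h ▸ hpA)) hy
      have hpg : p - x₀ ∈ g x := Submodule.mem_sup_left ((hmemA p).1 hpA)
      have hxg : x - x₀ ∈ g x :=
        Submodule.mem_sup_right (Submodule.mem_span_singleton_self _)
      have heq : p + t • (x - p) - x₀ = (p - x₀) + t • ((x - x₀) - (p - x₀)) := by
        rw [sub_sub_sub_cancel_right]; abel
      change p + t • (x - p) - x₀ ∈ g x
      rw [heq]
      exact (g x).add_mem hpg ((g x).smul_mem _ ((g x).sub_mem hxg hpg))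
  have hoff : ∀ ℓ ∈ H, δ / 2 * Fintype.card F ≤ #{x ∈ P | x ∈ ℓ ∧ x ∉ A} := by
    intro ℓ hℓ
    have h1 : #{x ∈ P | x ∈ ℓ ∧ x ∈ A} ≤ 1 := by
      rw [card_le_one]
      intro x hx y hy
      rw [mem_filter] at hx hy
      exact hHone ℓ hℓ x hx.2.1 y hy.2.1 hx.2.2 hy.2.2
    have h2 := card_filter_add_card_filter_not (s := {x ∈ P | x ∈ ℓ}) (fun x => x ∈ A)
    rw [filter_filter, filter_filter] at h2
    have h3 := hLP ℓ (hHL ℓ hℓ)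
    rw [← h2] at h3
    push_cast at h3
    have h1' : (#{x ∈ P | x ∈ ℓ ∧ x ∈ A} : ℝ) ≤ 1 := by exact_mod_cast h1
    linarith
  by_cases hex : ∃ D ∈ H.image h',
      c * (Fintype.card F : ℝ) ^ (k + 2) ≤ #{x ∈ P | x ∉ A ∧ g x = D}
  · right
    obtain ⟨D, hD, hDc⟩ := hex
    obtain ⟨ℓ, hℓ, rfl⟩ := mem_image.1 hD
    have hne : ({x ∈ P | x ∈ ℓ ∧ x ∉ A} : Finset V).Nonempty := by
      rw [← card_pos]
      have := hoff ℓ hℓ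
      have h1 : (0 : ℝ) < #{x ∈ P | x ∈ ℓ ∧ x ∉ A} := by linarith
      exact_mod_cast h1
    obtain ⟨x, hx⟩ := hne
    rw [mem_filter] at hx
    refine ⟨x₀ +ᵥ (h' ℓ : Set V), ?_, ⟨x₀, h' ℓ, ?_, rfl⟩, ?_⟩
    · intro y hy
      rw [mem_vadd_submodule_iff]
      exact Submodule.mem_sup_left ((hmemA y).1 hy)
    · rw [← hgh ℓ hℓ x hx.2.1 hx.2.2]
      have hxW : x - x₀ ∉ W := fun hh => hx.2.2 ((hmemA x).2 hh)
      rw [Submodule.finrank_sup_span_singleton hxW, hW]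
    · refine (mul_le_mul_of_nonneg_right (min_le_left _ _) (by positivity)).trans (hDc.trans ?_)
      refine Nat.cast_le.2 (card_le_card fun y hy => ?_)
      rw [mem_filter] at hy ⊢
      refine ⟨hy.1, ?_⟩
      rw [mem_vadd_submodule_iff, ← hy.2.2]
      exact Submodule.mem_sup_right (Submodule.mem_span_singleton_self _)
  · left
    push Not at hex
    have hD : ∀ D ∈ H.image h', c * #{ℓ ∈ H | h' ℓ = D} * (Fintype.card F : ℝ) ^ 2 ≤
        #{x ∈ P | x ∉ A ∧ g x = D} * (Fintype.card F : ℝ) ^ (k + 1) := by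
      intro D hD
      refine (h F V {ℓ ∈ H | h' ℓ = D} {x ∈ P | x ∉ A ∧ g x = D} ?_ ?_).resolve_right
        (not_le.2 (hex D hD))
      · intro ℓ hℓ
        exact hL ℓ (hHL ℓ (mem_filter.1 hℓ).1)
      · intro ℓ hℓ
        rw [mem_filter] at hℓ
        refine (hoff ℓ hℓ.1).trans (Nat.cast_le.2 (card_le_card fun x hx => ?_))
        simp only [mem_filter] at hx ⊢
        exact ⟨⟨hx.1, hx.2.2, (hgh ℓ hℓ.1 x hx.2.1 hx.2.2).trans hℓ.2⟩, hx.2.1⟩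
    have hsum := sum_le_sum hD
    rw [← sum_mul, ← sum_mul, ← mul_sum, ← Nat.cast_sum, ← Nat.cast_sum,
      ← card_eq_sum_card_image] at hsum
    have hP : ∑ D ∈ H.image h', #{x ∈ P | x ∉ A ∧ g x = D} ≤ #P := by
      rw [← card_biUnion]
      · exact card_le_card (biUnion_subset.2 fun D _ => filter_subset _ _)
      · intro D _ D' _ hne
        rw [Function.onFun, disjoint_left]
        intro x hx hx'
        rw [mem_filter] at hx hx'
        exact hne (hx.2.2.symm.trans hx'.2.2)
    have hP' : ((∑ D ∈ H.image h', #{x ∈ P | x ∉ A ∧ g x = D} : ℕ) : ℝ) ≤ #P := by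
      exact_mod_cast hP
    have hH' : (#{p ∈ P | p ∈ A} : ℝ) * (2 * (Fintype.card F : ℝ) ^ e) ≤ #H := by
      exact_mod_cast hHcard
    have hfin : (2 * c * η * (Fintype.card F : ℝ) ^ (e + 2)) * (Fintype.card F : ℝ) ^ (k + 1) ≤
        #P * (Fintype.card F : ℝ) ^ (k + 1) := by
      calc _ = c * ((η * (Fintype.card F : ℝ) ^ (k + 1)) * (2 * (Fintype.card F : ℝ) ^ e)) *
            (Fintype.card F : ℝ) ^ 2 := by ring
        _ ≤ c * #H * (Fintype.card F : ℝ) ^ 2 := by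
            gcongr
            exact (mul_le_mul_of_nonneg_right hAP (by positivity)).trans hH'
        _ ≤ _ := hsum
        _ ≤ _ := by gcongr
    refine le_trans ?_ (le_of_mul_le_mul_right hfin (by positivity))
    gcongr
    exact min_le_right _ _

/-- If every point lies on many lines, then every line lies in a rich plane of dimension `k + 1`,
unless there are many points. -/
lemma exists_rich_plane {e : ℕ} (ih : ∀ k < e, ShadedLineBound (k + 1)) {δ : ℝ} (hδ : 0 < δ)
    (k : ℕ) (hke : k ≤ e) :
    ∃ c : ℝ, 0 < c ∧
    ∀ (F : Type) [Field F] [Fintype F] (V : Type) [AddCommGroup V] [Module F V] [Finite V]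
      (L : Finset (Set V)) (P : Finset V), (∀ ℓ ∈ L, IsPlane F 1 ℓ) →
      (∀ ℓ ∈ L, δ * Fintype.card F ≤ #{p ∈ P | p ∈ ℓ}) →
      (∀ p ∈ P, 4 * Fintype.card F ^ e ≤ #{ℓ ∈ L | p ∈ ℓ}) →
      2 ≤ δ * Fintype.card F → #P < c * (Fintype.card F : ℝ) ^ (e + 2) →
      ∀ ℓ ∈ L, ∃ A : Set V, ℓ ⊆ A ∧ IsPlane F (k + 1) A ∧
        c * (Fintype.card F : ℝ) ^ (k + 1) ≤ #{p ∈ P | p ∈ A} := by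
  induction k with
  | zero =>
    refine ⟨δ, hδ, ?_⟩
    intro F _ _ V _ _ _ L P hL hLP _ _ _ ℓ hℓ
    exact ⟨ℓ, subset_rfl, hL ℓ hℓ, by simpa using hLP ℓ hℓ⟩
  | succ k ihk =>
    obtain ⟨c₁, hc₁, h₁⟩ := ihk (by omega)
    obtain ⟨c₂, hc₂, h₂⟩ := (ih k (by omega)).exists_plane_succ (e := e) (by omega) hδ hc₁
    refine ⟨min c₁ c₂, by positivity, ?_⟩
    intro F _ _ V _ _ _ L P hL hLP hPL hq hP ℓ hℓ
    obtain ⟨A, hℓA, hA, hAP⟩ := h₁ F V L P hL hLP hPL hq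
      (hP.trans_le (by gcongr; exact min_le_left _ _)) ℓ hℓ
    obtain ⟨B, hAB, hB, hBP⟩ := (h₂ F V L P hL hLP hPL hq A hA hAP).resolve_left
      (not_le.2 (hP.trans_le (by gcongr; exact min_le_right _ _)))
    exact ⟨B, hℓA.trans hAB, hB, le_trans (by gcongr; exact min_le_right _ _) hBP⟩

/-- If every point lies on at least `4 * q ^ e` lines, then there are at least a constant times
`q ^ (e + 2)` points. -/
lemma card_points_ge_of_degrees {e : ℕ} (ih : ∀ k < e, ShadedLineBound (k + 1)) {δ : ℝ}
    (hδ : 0 < δ) :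
    ∃ c : ℝ, 0 < c ∧
    ∀ (F : Type) [Field F] [Fintype F] (V : Type) [AddCommGroup V] [Module F V] [Finite V]
      (L : Finset (Set V)) (P : Finset V), L.Nonempty → (∀ ℓ ∈ L, IsPlane F 1 ℓ) →
      (∀ ℓ ∈ L, δ * Fintype.card F ≤ #{p ∈ P | p ∈ ℓ}) →
      (∀ p ∈ P, 4 * Fintype.card F ^ e ≤ #{ℓ ∈ L | p ∈ ℓ}) →
      c * (Fintype.card F : ℝ) ^ (e + 2) ≤ #P := by
  obtain ⟨η, hη, h⟩ := exists_rich_plane ih hδ e le_rfl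
  refine ⟨min (min η (η ^ 2 / 8)) (min ((δ / 2) ^ (e + 2)) ((η / 4) ^ (e + 2))),
    by positivity, ?_⟩
  intro F _ _ V _ _ _ L P ⟨ℓ₀, hℓ₀⟩ hL hLP hPL
  have hq0 : (0 : ℝ) < Fintype.card F := by exact_mod_cast Fintype.card_pos
  have hP1 : (1 : ℝ) ≤ #P := by
    have h1 : (0 : ℝ) < #{p ∈ P | p ∈ ℓ₀} := lt_of_lt_of_le (by positivity) (hLP ℓ₀ hℓ₀)
    have h2 : 0 < #{p ∈ P | p ∈ ℓ₀} := by exact_mod_cast h1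
    exact_mod_cast h2.trans_le (card_filter_le _ _)
  by_contra! hcon
  have hsmall : ∀ a : ℝ, 0 < a → min (min η (η ^ 2 / 8))
      (min ((δ / 2) ^ (e + 2)) ((η / 4) ^ (e + 2))) ≤ a ^ (e + 2) →
      1 < a * Fintype.card F := by
    intro a ha hmin
    by_contra! hle
    have h1 : (a * Fintype.card F) ^ (e + 2) ≤ 1 := pow_le_one₀ (by positivity) hle
    rw [mul_pow] at h1
    have h2 := mul_le_mul_of_nonneg_right hmin (by positivity : (0 : ℝ) ≤ Fintype.card F ^ (e + 2))
    linarith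
  have hq1 := hsmall (δ / 2) (by positivity) ((min_le_right _ _).trans (min_le_left _ _))
  have hq2 := hsmall (η / 4) (by positivity) ((min_le_right _ _).trans (min_le_right _ _))
  have hrich := h F V L P hL hLP hPL (by linarith)
    (hcon.trans_le (by gcongr; exact (min_le_left _ _).trans (min_le_left _ _)))
  obtain ⟨A, -, hA, hAP⟩ := hrich ℓ₀ hℓ₀
  have hex : ∀ p ∈ P, ∃ B : Set V, p ∈ B ∧ B ≠ A ∧ IsPlane F (e + 1) B ∧
      η * (Fintype.card F : ℝ) ^ (e + 1) ≤ #{p ∈ P | p ∈ B} := by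
    intro p hp
    have h1 := card_lines_not_subset_ge le_rfl hA L hL (hPL p hp)
    have h2 : 0 < #{ℓ ∈ L | p ∈ ℓ ∧ ¬ ℓ ⊆ A} :=
      lt_of_lt_of_le (Nat.mul_pos two_pos (pow_pos Fintype.card_pos _)) h1
    obtain ⟨ℓ, hℓ⟩ := card_pos.1 h2
    rw [mem_filter] at hℓ
    obtain ⟨B, hℓB, hB, hBP⟩ := hrich ℓ hℓ.1
    exact ⟨B, hℓB hℓ.2.1, fun hBA => hℓ.2.2 (hBA ▸ hℓB), hB, hBP⟩
  choose! Q hQmem hQne hQ hQP using hex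
  let S : Finset (Set V) := ({p ∈ P | p ∈ A} : Finset V).image Q
  have hS : ∀ B ∈ S, B ≠ A ∧ IsPlane F (e + 1) B ∧
      η * (Fintype.card F : ℝ) ^ (e + 1) ≤ #{p ∈ P | p ∈ B} := by
    intro B hB
    obtain ⟨p, hp, rfl⟩ := mem_image.1 hB
    have hp := (mem_filter.1 hp).1
    exact ⟨hQne p hp, hQ p hp, hQP p hp⟩
  have hScard : η * (Fintype.card F : ℝ) ≤ #S := by
    have h1 := card_mul_le_card_mul (s := {p ∈ P | p ∈ A}) (t := S) (m := 1)
      (n := Fintype.card F ^ e) (fun p B => p ∈ B) ?_ ?_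
    · have h2 : (#{p ∈ P | p ∈ A} : ℝ) ≤ #S * (Fintype.card F : ℝ) ^ e := by
        rw [mul_one] at h1; exact_mod_cast h1
      have h3 : η * (Fintype.card F : ℝ) * (Fintype.card F : ℝ) ^ e ≤
          #S * (Fintype.card F : ℝ) ^ e := by
        refine le_trans (le_of_eq ?_) (hAP.trans h2)
        ring
      exact le_of_mul_le_mul_right h3 (by positivity)
    · intro p hp
      rw [Nat.succ_le_iff, card_pos]
      exact ⟨Q p, by
        rw [mem_bipartiteAbove]
        exact ⟨mem_image_of_mem _ hp, hQmem p (mem_filter.1 hp).1⟩⟩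
    · intro B hB
      refine le_trans ?_ (hA.ncard_inter_le (hS B hB).2.1 (hS B hB).1.symm)
      refine le_trans (card_le_card ?_) (card_filter_mem_le_ncard P (A ∩ B))
      intro p hp
      simp only [mem_bipartiteBelow, mem_filter] at hp
      exact mem_filter.2 ⟨hp.1.1, hp.1.2, hp.2⟩
  set N : ℕ := ⌊η * (Fintype.card F : ℝ) / 2⌋₊ with hN
  have hN1 : (N : ℝ) ≤ η * Fintype.card F / 2 := Nat.floor_le (by positivity)
  have hN2 : η * Fintype.card F / 4 ≤ N := by
    have := Nat.lt_floor_add_one (η * (Fintype.card F : ℝ) / 2)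
    rw [← hN] at this
    linarith
  obtain ⟨T, hTS, hT⟩ := exists_subset_card_eq (s := S) (n := N) (by
    have : (N : ℝ) ≤ #S := by linarith
    exact_mod_cast this)
  have hfin := card_mul_sub_le_card P (η * (Fintype.card F : ℝ) ^ (e + 1))
    ((Fintype.card F : ℝ) ^ e) (by positivity) T (fun B hB => (hS B (hTS hB)).2.2)
    (fun B hB B' hB' hne => by
      exact_mod_cast (hS B (hTS hB)).2.1.ncard_inter_le (hS B' (hTS hB')).2.1 hne)
  rw [hT] at hfin
  have h1 : η ^ 2 / 8 * (Fintype.card F : ℝ) ^ (e + 2) ≤ #P := by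
    refine le_trans ?_ hfin
    calc η ^ 2 / 8 * (Fintype.card F : ℝ) ^ (e + 2)
        = η * Fintype.card F / 4 * (η * Fintype.card F / 2 * (Fintype.card F : ℝ) ^ e) := by ring
      _ ≤ N * (η * (Fintype.card F : ℝ) ^ (e + 1) - N * (Fintype.card F : ℝ) ^ e) := by
        gcongr
        have : η * (Fintype.card F : ℝ) ^ (e + 1) - N * (Fintype.card F : ℝ) ^ e =
          (η * Fintype.card F - N) * (Fintype.card F : ℝ) ^ e := by ring
        rw [this]
        gcongr
        linarith
  refine absurd h1 (not_le.2 (hcon.trans_le ?_))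
  gcongr
  exact (min_le_left _ _).trans (min_le_right _ _)

lemma shadedLineBound_succ (e : ℕ) : ShadedLineBound (e + 1) := by
  induction e using Nat.strong_induction_on with
  | _ e ih =>
    intro δ hδ
    obtain ⟨c, hc, h⟩ := card_points_ge_of_degrees ih (half_pos hδ)
    refine ⟨min c (δ / 8), by positivity, ?_⟩
    intro F _ _ V _ _ _ L P hL hLP
    have hq0 : (0 : ℝ) < Fintype.card F := by exact_mod_cast Fintype.card_pos
    by_cases hlt : 4 * (Fintype.card F : ℝ) ^ e * #P < δ * Fintype.card F / 2 * #L
    · right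
      obtain ⟨L', hL', P', hP', hne, h1, h2⟩ := exists_subsets_degrees_ge L P
        (δ * Fintype.card F) (4 * (Fintype.card F : ℝ) ^ e) (by positivity) hLP hlt
      have h3 := h F V L' P' hne (fun ℓ hℓ => hL ℓ (hL' hℓ))
        (fun ℓ hℓ => by have := h1 ℓ hℓ; linarith) (fun p hp => by exact_mod_cast h2 p hp)
      calc _ ≤ c * (Fintype.card F : ℝ) ^ (e + 2) := by gcongr; exact min_le_left _ _
        _ ≤ #P' := h3
        _ ≤ #P := by exact_mod_cast card_le_card hP'
    · left
      calc _ ≤ δ / 8 * #L * (Fintype.card F : ℝ) ^ 2 := by gcongr; exact min_le_right _ _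
        _ = (δ * Fintype.card F / 2 * #L) * (Fintype.card F / 4) := by ring
        _ ≤ (4 * (Fintype.card F : ℝ) ^ e * #P) * (Fintype.card F / 4) :=
          mul_le_mul_of_nonneg_right (not_lt.1 hlt) (by positivity)
        _ = _ := by ring

end Incidences

/-- **Theorem 1 (main line theorem).** If a collection of lines in `Fⁿ` has cardinality at
least `|F|^(2(d-1)+β)`, then its union has cardinality at least `c · |F|^(d+β)`, where
`c > 0` depends only on `d`. -/
theorem union_of_lines_lower_bound (d : ℕ) (hd : 1 ≤ d) :
    ∃ c : ℝ, 0 < c ∧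
      ∀ (F : Type) [Field F] [Fintype F] (n : ℕ), 1 ≤ n →
        ∀ β : ℝ, 0 ≤ β → β ≤ 1 →
          ∀ L : Set (Set (Fin n → F)),
            (∀ ℓ ∈ L, IsPlane F 1 ℓ) →
            (L.ncard : ℝ) ≥ (Fintype.card F : ℝ) ^ (2 * ((d : ℝ) - 1) + β) →
            ((⋃₀ L).ncard : ℝ) ≥ c * (Fintype.card F : ℝ) ^ ((d : ℝ) + β) := by
  classical
  obtain ⟨e, rfl⟩ : ∃ e, d = e + 1 := ⟨d - 1, by omega⟩
  obtain ⟨c, hc, h⟩ := shadedLineBound_succ e 1 one_pos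
  refine ⟨c, hc, ?_⟩
  intro F _ _ n _ β hβ0 hβ1 L hL hLcard
  have hq1 : (1 : ℝ) ≤ Fintype.card F := by exact_mod_cast Fintype.card_pos
  have hq0 : (0 : ℝ) < Fintype.card F := by linarith
  rw [Set.ncard_eq_toFinset_card L] at hLcard
  rw [Set.ncard_eq_toFinset_card (⋃₀ L)]
  have hshade : ∀ ℓ ∈ L.toFinite.toFinset, 1 * (Fintype.card F : ℝ) ≤
      (Finset.card {p ∈ (⋃₀ L).toFinite.toFinset | p ∈ ℓ} : ℕ) := by
    intro ℓ hℓ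
    have hℓL : ℓ ∈ L := by simpa using hℓ
    rw [one_mul, Nat.cast_le]
    calc Fintype.card F = ℓ.ncard := by rw [(hL ℓ hℓL).ncard_eq, pow_one]
      _ = ℓ.toFinite.toFinset.card := Set.ncard_eq_toFinset_card ℓ
      _ ≤ _ := Finset.card_le_card fun x hx => by
        simp only [Set.Finite.mem_toFinset, Finset.mem_filter] at hx ⊢
        exact ⟨Set.mem_sUnion_of_mem hx hℓL, hx⟩
  rcases h F (Fin n → F) L.toFinite.toFinset (⋃₀ L).toFinite.toFinset (by simpa using hL)
      (fun ℓ hℓ => by convert hshade ℓ hℓ)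
    with h1 | h1
  · have h2 : c * (Fintype.card F : ℝ) ^ (((e + 1 : ℕ) : ℝ) + β) *
        (Fintype.card F : ℝ) ^ (e + 1) ≤
        (⋃₀ L).toFinite.toFinset.card * (Fintype.card F : ℝ) ^ (e + 1) := by
      refine le_trans ?_ h1
      calc _ = c * (Fintype.card F : ℝ) ^ (2 * (((e + 1 : ℕ) : ℝ) - 1) + β) *
            (Fintype.card F : ℝ) ^ 2 := by
            rw [← Real.rpow_natCast, ← Real.rpow_natCast, mul_assoc, mul_assoc,
              ← Real.rpow_add hq0, ← Real.rpow_add hq0]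
            congr 2
            push_cast
            ring
        _ ≤ _ := by gcongr
    exact le_of_mul_le_mul_right h2 (by positivity)
  · refine le_trans ?_ h1
    rw [← Real.rpow_natCast]
    refine mul_le_mul_of_nonneg_left (Real.rpow_le_rpow_of_exponent_le hq1 ?_) hc.le
    push_cast
    linarith
end

section
/- Let d ≥ k > k' ≥ 0 be integers. There exists a constant c > 0 depending only on d, k, k' such that: for every finite field F, every n, every real β with 0 ≤ β ≤ k'+1, and every collection L of k-planes in F^n with |L| ≥ |F|^{(k+1)(d-k)+β}, the set of all k'-planes contained in at least one member of L has cardinality at least c · |F|^{(k'+1)(d-k')+β}. -/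
open scoped Pointwise

section PointsAndSubspaces

open Module Finset
open scoped Classical

variable {F V : Type} [Field F] [AddCommGroup V] [Module F V] [Finite V]

lemma inf_eq_of_finrank_succ {A B C : Submodule F V} {n : ℕ} (hAB : A ≠ B)
    (hA : finrank F A = n + 1) (hB : finrank F B = n + 1) (hC : finrank F C = n)
    (hCA : C ≤ A) (hCB : C ≤ B) : A ⊓ B = C := by
  refine (Submodule.eq_of_le_of_finrank_le (le_inf hCA hCB) ?_).symm
  have hlt : A ⊓ B < A := by
    refine lt_of_le_of_ne inf_le_left fun h => hAB ?_
    exact Submodule.eq_of_le_of_finrank_eq (inf_eq_left.1 h) (hA.trans hB.symm)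
  have := Submodule.finrank_lt_finrank_of_lt hlt
  omega

lemma finrank_inf_le_of_ne {A B : Submodule F V} {n : ℕ} (hAB : A ≠ B)
    (hA : finrank F A = n + 1) (hB : finrank F B = n + 1) :
    finrank F (A ⊓ B : Submodule F V) ≤ n := by
  have hlt : A ⊓ B < A := by
    refine lt_of_le_of_ne inf_le_left fun h => hAB ?_
    exact Submodule.eq_of_le_of_finrank_eq (inf_eq_left.1 h) (hA.trans hB.symm)
  have := Submodule.finrank_lt_finrank_of_lt hlt
  omega

lemma finrank_sup_of_finrank_succ {A B C : Submodule F V} {n : ℕ} (hAB : A ≠ B)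
    (hA : finrank F A = n + 1) (hB : finrank F B = n + 1) (hC : finrank F C = n)
    (hCA : C ≤ A) (hCB : C ≤ B) : finrank F (A ⊔ B : Submodule F V) = n + 2 := by
  have h := Submodule.finrank_sup_add_finrank_inf_eq A B
  rw [inf_eq_of_finrank_succ hAB hA hB hC hCA hCB] at h
  omega

lemma sum_card_diff_le (X : Finset V) (n : ℕ) (C D : Submodule F V) (hC : finrank F C = n)
    (T : Finset (Submodule F V)) (hT : ∀ P ∈ T, finrank F P = n + 1 ∧ C ≤ P ∧ P ≤ D) :
    ∑ P ∈ T, #{x ∈ X | x ∈ P ∧ x ∉ C} ≤ #{x ∈ X | x ∈ D} := by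
  rw [← card_biUnion]
  · refine card_le_card fun x hx => ?_
    simp only [mem_biUnion, mem_filter] at hx ⊢
    obtain ⟨P, hP, hx, hxP, -⟩ := hx
    exact ⟨hx, (hT P hP).2.2 hxP⟩
  · intro P hP Q hQ hPQ
    rw [Function.onFun, disjoint_left]
    intro x hx hx'
    simp only [mem_filter] at hx hx'
    obtain ⟨hP1, hP2, -⟩ := hT P hP
    obtain ⟨hQ1, hQ2, -⟩ := hT Q hQ
    apply hx.2.2
    rw [← inf_eq_of_finrank_succ hPQ hP1 hQ1 hC hP2 hQ2]
    exact ⟨hx.2.1, hx'.2.1⟩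

variable [Fintype F]

lemma card_submodule_eq_pow (P : Submodule F V) :
    Nat.card P = Fintype.card F ^ finrank F P := by
  rw [natCard_eq_pow_finrank (K := F), Nat.card_eq_fintype_card]

lemma card_filter_mem_le (X : Finset V) (P : Submodule F V) :
    #{x ∈ X | x ∈ P} ≤ Fintype.card F ^ finrank F P := by
  rw [← card_submodule_eq_pow, ← Set.ncard_coe_finset]
  change _ ≤ Nat.card (P : Set V)
  rw [Nat.card_coe_set_eq]
  exact Set.ncard_le_ncard (fun x hx => by simpa using (mem_filter.1 hx).2)

lemma card_inter_union_ge (X : Finset V) (m : ℕ) (A : ℝ) (T : Finset (Submodule F V))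
    (hT : ∀ P ∈ T, finrank F P = m + 1) (hA : ∀ P ∈ T, A ≤ #{x ∈ X | x ∈ P}) :
    (#T : ℝ) * A - (#T : ℝ) ^ 2 * (Fintype.card F : ℝ) ^ m ≤ #{x ∈ X | ∃ P ∈ T, x ∈ P} := by
  induction T using Finset.induction_on with
  | empty => simp
  | insert P T hP ih =>
    have ih' := ih (fun Q hQ => hT Q (mem_insert_of_mem hQ))
      (fun Q hQ => hA Q (mem_insert_of_mem hQ))
    have hPA := hA P (mem_insert_self _ _)
    have hunion : ({x ∈ X | ∃ Q ∈ insert P T, x ∈ Q} : Finset V)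
        = {x ∈ X | x ∈ P} ∪ {x ∈ X | ∃ Q ∈ T, x ∈ Q} := by
      ext x; simp only [mem_filter, mem_union, mem_insert, exists_eq_or_imp]; tauto
    have hinter : #({x ∈ X | x ∈ P} ∩ {x ∈ X | ∃ Q ∈ T, x ∈ Q})
        ≤ #T * Fintype.card F ^ m := by
      have hsub : ({x ∈ X | x ∈ P} ∩ {x ∈ X | ∃ Q ∈ T, x ∈ Q} : Finset V)
          ⊆ T.biUnion fun Q => {x ∈ X | x ∈ P ⊓ Q} := by
        intro x hx
        simp only [mem_inter, mem_filter, mem_biUnion, Submodule.mem_inf] at hx ⊢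
        obtain ⟨⟨hx, hxP⟩, -, Q, hQ, hxQ⟩ := hx
        exact ⟨Q, hQ, hx, hxP, hxQ⟩
      refine (card_le_card hsub).trans (card_biUnion_le_card_mul _ _ _ fun Q hQ => ?_)
      refine (card_filter_mem_le X _).trans (Nat.pow_le_pow_right Fintype.card_pos ?_)
      refine finrank_inf_le_of_ne ?_ (hT P (mem_insert_self _ _)) (hT Q (mem_insert_of_mem hQ))
      rintro rfl
      exact hP hQ
    have hcard := card_union_add_card_inter {x ∈ X | x ∈ P} {x ∈ X | ∃ Q ∈ T, x ∈ Q}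
    rw [hunion, card_insert_of_notMem hP]
    have hcard' : (#({x ∈ X | x ∈ P} ∪ {x ∈ X | ∃ Q ∈ T, x ∈ Q}) : ℝ)
        + #({x ∈ X | x ∈ P} ∩ {x ∈ X | ∃ Q ∈ T, x ∈ Q})
        = #{x ∈ X | x ∈ P} + #{x ∈ X | ∃ Q ∈ T, x ∈ Q} := by exact_mod_cast hcard
    have hinter' : (#({x ∈ X | x ∈ P} ∩ {x ∈ X | ∃ Q ∈ T, x ∈ Q}) : ℝ)
        ≤ #T * (Fintype.card F : ℝ) ^ m := by exact_mod_cast hinter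
    have hq : 0 ≤ (Fintype.card F : ℝ) ^ m := by positivity
    have hTq : 0 ≤ (#T : ℝ) * (Fintype.card F : ℝ) ^ m := by positivity
    push_cast
    nlinarith

lemma card_filter_diff_ge (X : Finset V) (C P : Submodule F V) :
    (#{x ∈ X | x ∈ P} : ℝ) - (Fintype.card F : ℝ) ^ finrank F C
      ≤ #{x ∈ X | x ∈ P ∧ x ∉ C} := by
  have h1 : #{x ∈ X | x ∈ P} ≤ #{x ∈ X | x ∈ P ∧ x ∉ C} + #{x ∈ X | x ∈ C} := by
    refine (card_le_card fun x hx => ?_).trans (card_union_le _ _)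
    simp only [mem_filter, mem_union] at hx ⊢
    tauto
  have h2 := h1.trans (Nat.add_le_add_left (card_filter_mem_le X C) _)
  rw [sub_le_iff_le_add]
  exact_mod_cast h2

lemma card_univ_filter_mem [Fintype V] (P : Submodule F V) :
    #{x : V | x ∈ P} = Fintype.card F ^ finrank F P := by
  rw [← card_submodule_eq_pow, ← Set.ncard_coe_finset]
  change _ = Nat.card (P : Set V)
  rw [Nat.card_coe_set_eq]
  congr 1
  ext x
  simp

lemma two_le_card_field : (2 : ℝ) ≤ Fintype.card F := by
  exact_mod_cast Fintype.one_lt_card (α := F)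

lemma card_pencil_le (m : ℕ) (Y S : Submodule F V) (hY : finrank F Y = m)
    (hS : finrank F S = m + 2) (T : Finset (Submodule F V))
    (hT : ∀ P ∈ T, finrank F P = m + 1 ∧ Y ≤ P ∧ P ≤ S) :
    (#T : ℝ) ≤ 2 * Fintype.card F := by
  have : Fintype V := Fintype.ofFinite V
  have h := sum_card_diff_le (univ : Finset V) m Y S hY T hT
  rw [card_univ_filter_mem, hS] at h
  set q : ℝ := (Fintype.card F : ℝ) with hq
  have hq2 : 2 ≤ q := two_le_card_field
  have h' : ∑ P ∈ T, (#{x : V | x ∈ P ∧ x ∉ Y} : ℝ) ≤ q ^ (m + 2) := by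
    rw [hq]; exact_mod_cast h
  have h1 : ∑ P ∈ T, q ^ m * (q - 1) ≤ ∑ P ∈ T, (#{x : V | x ∈ P ∧ x ∉ Y} : ℝ) := by
    refine sum_le_sum fun P hP => ?_
    have := card_filter_diff_ge (univ : Finset V) Y P
    rw [card_univ_filter_mem, (hT P hP).1, hY] at this
    push_cast at this
    refine le_trans (le_of_eq ?_) this
    rw [hq]; ring
  rw [sum_const, nsmul_eq_mul] at h1
  have h2 : q ^ m * (#T * (q - 1)) ≤ q ^ m * q ^ 2 := by
    calc q ^ m * (#T * (q - 1)) = #T * (q ^ m * (q - 1)) := by ring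
      _ ≤ q ^ (m + 2) := h1.trans h'
      _ = _ := by ring
  have h3 := le_of_mul_le_mul_left h2 (by positivity)
  nlinarith [Nat.cast_nonneg (α := ℝ) #T]

end PointsAndSubspaces

section RichSubspaces

open Module Finset
open scoped Classical

variable {F V : Type} [Field F] [AddCommGroup V] [Module F V]

section

variable [Finite V]

/-- If every `Y ∈ 𝓨` lies in many members of `𝓟`, then a given `P ∈ 𝓟` has many other members of
`𝓟` that meet it in a member of a prescribed finite subfamily of `𝓨`. -/
lemma card_neighbours_ge (m : ℕ) (P : Submodule F V) (hP : finrank F P = m + 1)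
    (𝓨 𝓟 : Finset (Submodule F V)) (h𝓨 : ∀ Y ∈ 𝓨, finrank F Y = m ∧ Y ≤ P)
    (h𝓟 : ∀ Q ∈ 𝓟, finrank F Q = m + 1) (N : ℝ)
    (hN : ∀ Y ∈ 𝓨, N + 1 ≤ #{Q ∈ 𝓟 | Y ≤ Q}) :
    #𝓨 * N ≤ #{Q ∈ 𝓟 | Q ≠ P ∧ ∃ Y ∈ 𝓨, Y ≤ Q} := by
  have heq : ({Q ∈ 𝓟 | Q ≠ P ∧ ∃ Y ∈ 𝓨, Y ≤ Q} : Finset _)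
      = 𝓨.biUnion fun Y => {Q ∈ 𝓟 | Y ≤ Q}.erase P := by
    ext Q
    simp only [mem_filter, mem_biUnion, mem_erase]
    constructor
    · rintro ⟨hQ, hQP, Y, hY, hYQ⟩
      exact ⟨Y, hY, hQP, hQ, hYQ⟩
    · rintro ⟨Y, hY, hQP, hQ, hYQ⟩
      exact ⟨hQ, hQP, Y, hY, hYQ⟩
  rw [heq, card_biUnion]
  · push_cast
    rw [← nsmul_eq_mul]
    refine card_nsmul_le_sum _ _ _ fun Y hY => ?_
    have h1 := hN Y hY
    have h2 : (#{Q ∈ 𝓟 | Y ≤ Q} : ℝ) ≤ #({Q ∈ 𝓟 | Y ≤ Q}.erase P) + 1 := by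
      have := pred_card_le_card_erase (s := {Q ∈ 𝓟 | Y ≤ Q}) (a := P)
      exact_mod_cast (by omega : #{Q ∈ 𝓟 | Y ≤ Q} ≤ #({Q ∈ 𝓟 | Y ≤ Q}.erase P) + 1)
    linarith
  · intro Y hY Z hZ hYZ
    rw [Function.onFun, disjoint_left]
    intro Q hQ hQ'
    simp only [mem_filter, mem_erase] at hQ hQ'
    apply hYZ
    rw [← inf_eq_of_finrank_succ hQ.1 (h𝓟 Q hQ.2.1) hP (h𝓨 Y hY).1 hQ.2.2 (h𝓨 Y hY).2,
      inf_eq_of_finrank_succ hQ.1 (h𝓟 Q hQ.2.1) hP (h𝓨 Z hZ).1 hQ'.2.2 (h𝓨 Z hZ).2]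

end

variable [Fintype F]

lemma card_ge_of_small_field (X : Finset V) (m s : ℕ) {a : ℝ} (ha : 0 < a)
    (hq : (Fintype.card F : ℝ) < 4 / a) (P : Submodule F V)
    (hX : a * (Fintype.card F : ℝ) ^ (m + 1) ≤ #{x ∈ X | x ∈ P}) :
    a * (a / 4) ^ s * (Fintype.card F : ℝ) ^ (m + 1 + s) ≤ #X := by
  refine le_trans ?_ (hX.trans (mod_cast card_filter_le _ _))
  set q : ℝ := (Fintype.card F : ℝ)
  have hq0 : 0 ≤ q := Nat.cast_nonneg _
  rw [lt_div_iff₀ ha] at hq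
  have h1 : (a / 4 * q) ^ s ≤ 1 := pow_le_one₀ (by positivity) (by linarith)
  calc a * (a / 4) ^ s * q ^ (m + 1 + s) = a * q ^ (m + 1) * (a / 4 * q) ^ s := by
        rw [mul_pow]; ring
    _ ≤ a * q ^ (m + 1) * 1 := mul_le_mul_of_nonneg_left h1 (by positivity)
    _ = _ := mul_one _

variable [Finite V]

lemma card_union_ge_of_many (X : Finset V) (m : ℕ) {a : ℝ} (ha : 0 < a)
    (hq : 4 / a ≤ Fintype.card F) (T : Finset (Submodule F V))
    (hT : ∀ P ∈ T, finrank F P = m + 1)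
    (hX : ∀ P ∈ T, a * (Fintype.card F : ℝ) ^ (m + 1) ≤ #{x ∈ X | x ∈ P})
    (hcard : a / 4 * Fintype.card F ≤ #T) :
    a ^ 2 / 8 * (Fintype.card F : ℝ) ^ (m + 2) ≤ #{x ∈ X | ∃ P ∈ T, x ∈ P} := by
  obtain ⟨T', hT'T, hT'⟩ := exists_subset_card_eq (Nat.ceil_le.2 hcard)
  have h := card_inter_union_ge X m _ T' (fun P hP => hT P (hT'T hP))
    (fun P hP => hX P (hT'T hP))
  have hmono : (#{x ∈ X | ∃ P ∈ T', x ∈ P} : ℝ) ≤ #{x ∈ X | ∃ P ∈ T, x ∈ P} := by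
    refine mod_cast card_le_card fun x hx => ?_
    simp only [mem_filter] at hx ⊢
    obtain ⟨hx, P, hP, hxP⟩ := hx
    exact ⟨hx, P, hT'T hP, hxP⟩
  refine le_trans ?_ (h.trans hmono)
  rw [hT']
  set q : ℝ := (Fintype.card F : ℝ)
  have hq2 : 2 ≤ q := two_le_card_field
  rw [div_le_iff₀ ha] at hq
  have h1 : a / 4 * q ≤ ⌈a / 4 * q⌉₊ := Nat.le_ceil _
  have h2 : (⌈a / 4 * q⌉₊ : ℝ) < a / 4 * q + 1 := Nat.ceil_lt_add_one (by positivity)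
  set t : ℝ := (⌈a / 4 * q⌉₊ : ℝ)
  have hqm : 0 ≤ q ^ m := by positivity
  have key : a ^ 2 / 8 * q ^ 2 ≤ t * (a * q) - t ^ 2 := by
    have h3 : t ≤ a * q / 2 := by linarith
    nlinarith
  calc a ^ 2 / 8 * q ^ (m + 2) = q ^ m * (a ^ 2 / 8 * q ^ 2) := by ring
    _ ≤ q ^ m * (t * (a * q) - t ^ 2) := mul_le_mul_of_nonneg_left key hqm
    _ = _ := by ring

lemma card_union_diff_ge_of_few (X : Finset V) (m : ℕ) {a : ℝ} (ha : 0 < a)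
    (hq : 4 / a ≤ Fintype.card F) (P S : Submodule F V) (hP : finrank F P = m + 1)
    (T : Finset (Submodule F V))
    (hT : ∀ Q ∈ T, finrank F Q = m + 1 ∧ Q ≠ P ∧ Q ≤ S)
    (hX : ∀ Q ∈ T, a * (Fintype.card F : ℝ) ^ (m + 1) ≤ #{x ∈ X | x ∈ Q})
    (hcard : #T ≤ a / 4 * Fintype.card F) :
    a / 4 * (Fintype.card F : ℝ) ^ (m + 1) * #T ≤ #{x ∈ X | x ∈ S ∧ x ∉ P} := by
  have h := card_inter_union_ge {x ∈ X | x ∉ P} m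
    (a * (Fintype.card F : ℝ) ^ (m + 1) - (Fintype.card F : ℝ) ^ m) T
    (fun Q hQ => (hT Q hQ).1) ?_
  · have hmono : (#{x ∈ {x ∈ X | x ∉ P} | ∃ Q ∈ T, x ∈ Q} : ℝ) ≤ #{x ∈ X | x ∈ S ∧ x ∉ P} := by
      refine mod_cast card_le_card fun x hx => ?_
      simp only [mem_filter] at hx ⊢
      obtain ⟨⟨hx, hxP⟩, Q, hQ, hxQ⟩ := hx
      exact ⟨hx, (hT Q hQ).2.2 hxQ, hxP⟩
    refine le_trans ?_ (h.trans hmono)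
    set q : ℝ := (Fintype.card F : ℝ)
    have hq2 : 2 ≤ q := two_le_card_field
    rw [div_le_iff₀ ha] at hq
    set t : ℝ := (#T : ℝ)
    have ht : 0 ≤ t := Nat.cast_nonneg _
    have hqm : 0 ≤ q ^ m := by positivity
    have key : a / 4 * q * t ≤ t * (a * q - 1) - t ^ 2 := by nlinarith
    calc a / 4 * q ^ (m + 1) * t = q ^ m * (a / 4 * q * t) := by ring
      _ ≤ q ^ m * (t * (a * q - 1) - t ^ 2) := mul_le_mul_of_nonneg_left key hqm
      _ = _ := by ring
  · intro Q hQ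
    have h1 := card_filter_diff_ge X (Q ⊓ P) Q
    have h2 : (Fintype.card F : ℝ) ^ finrank F (Q ⊓ P : Submodule F V)
        ≤ (Fintype.card F : ℝ) ^ m :=
      pow_le_pow_right₀ (one_le_two.trans two_le_card_field)
        (finrank_inf_le_of_ne (hT Q hQ).2.1 (hT Q hQ).1 hP)
    have h3 : (#{x ∈ X | x ∈ Q ∧ x ∉ Q ⊓ P} : ℝ)
        ≤ #{x ∈ {x ∈ X | x ∉ P} | x ∈ Q} := by
      refine mod_cast card_le_card fun x hx => ?_
      simp only [mem_filter, Submodule.mem_inf] at hx ⊢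
      tauto
    linarith [hX Q hQ]

end RichSubspaces

section RichChain

open Module Finset
open scoped Classical

/-- Bounds from below the size of a set `X` that is dense in every member of a family `𝓟` of
subspaces, when `𝓟` is connected to a family `𝓨` of subspaces of one dimension less by a dense
incidence relation. -/
theorem card_ge_of_dense_incidences (r : ℕ) : ∀ a : ℝ, 0 < a → a ≤ 1 →
    ∃ C c : ℝ, 2 ≤ C ∧ 0 < c ∧
      ∀ (F V : Type) [Field F] [Fintype F] [AddCommGroup V] [Module F V] [Finite V]
        (X : Finset V) (m : ℕ) (𝓨 𝓟 : Finset (Submodule F V)), 𝓟.Nonempty →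
        (∀ Y ∈ 𝓨, finrank F Y = m) → (∀ P ∈ 𝓟, finrank F P = m + 1) →
        (∀ P ∈ 𝓟, a * (Fintype.card F : ℝ) ^ (m + 1) ≤ #{x ∈ X | x ∈ P}) →
        (∀ P ∈ 𝓟, a * (Fintype.card F : ℝ) ≤ #{Y ∈ 𝓨 | Y ≤ P}) →
        (∀ Y ∈ 𝓨, C * (Fintype.card F : ℝ) ^ r ≤ #{P ∈ 𝓟 | Y ≤ P}) →
        c * (Fintype.card F : ℝ) ^ (m + 2 + r) ≤ #X := by
  induction r with
  | zero =>
    intro a ha ha1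
    refine ⟨2, a ^ 2 / 8, le_rfl, by positivity, ?_⟩
    intro F V _ _ _ _ _ X m 𝓨 𝓟 hne h𝓨 h𝓟 hX hP hY
    obtain ⟨P, hPm⟩ := hne
    rcases lt_or_ge (Fintype.card F : ℝ) (4 / a) with hq | hq
    · refine le_trans ?_ (card_ge_of_small_field X m 1 ha hq P (hX P hPm))
      have : 0 ≤ (Fintype.card F : ℝ) ^ (m + 2) := by positivity
      have h2 : a * (a / 4) ^ 1 * (Fintype.card F : ℝ) ^ (m + 1 + 1)
        = a ^ 2 / 4 * (Fintype.card F : ℝ) ^ (m + 2) := by ring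
      rw [h2]
      have : 0 ≤ a ^ 2 * (Fintype.card F : ℝ) ^ (m + 2) := by positivity
      simp only [add_zero]
      linarith
    · have hnb := card_neighbours_ge m P (h𝓟 P hPm) {Y ∈ 𝓨 | Y ≤ P} 𝓟
        (fun Y hY => ⟨h𝓨 Y (mem_filter.1 hY).1, (mem_filter.1 hY).2⟩) h𝓟 1
        (fun Y hY' => by have := hY Y (mem_filter.1 hY').1; linarith)
      have h := card_union_ge_of_many X m ha hq _
        (fun Q hQ => h𝓟 Q (mem_filter.1 hQ).1) (fun Q hQ => hX Q (mem_filter.1 hQ).1)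
        (le_trans (by
          have := hP P hPm
          have h0 : 0 ≤ a * (Fintype.card F : ℝ) := by positivity
          linarith) hnb)
      exact h.trans (mod_cast card_filter_le _ _)
  | succ r ih =>
    intro a ha ha1
    obtain ⟨C₁, c₁, hC₁, hc₁, H⟩ := ih (a ^ 2 / 8) (by positivity) (by nlinarith)
    refine ⟨max 2 (16 * C₁ / a), min c₁ (min (a * (a / 4) ^ (r + 2)) (a ^ 2 / 8)),
      le_max_left _ _, by positivity, ?_⟩
    intro F V _ _ _ _ _ X m 𝓨 𝓟 hne h𝓨 h𝓟 hX hP hY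
    have hq2 : (2 : ℝ) ≤ Fintype.card F := two_le_card_field
    rcases lt_or_ge (Fintype.card F : ℝ) (4 / a) with hq | hq
    · obtain ⟨P, hPm⟩ := hne
      refine le_trans ?_ (card_ge_of_small_field X m (r + 2) ha hq P (hX P hPm))
      rw [show m + 2 + (r + 1) = m + 1 + (r + 2) by ring]
      gcongr
      exact (min_le_right _ _).trans (min_le_left _ _)
    have : Fintype (Submodule F V) := Fintype.ofFinite _
    set 𝓢 : Finset (Submodule F V) :=
      {S | finrank F S = m + 2 ∧ a / 4 * Fintype.card F ≤ #{P ∈ 𝓟 | P ≤ S}} with h𝓢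
    by_cases hrich : ∀ P ∈ 𝓟, C₁ * (Fintype.card F : ℝ) ^ r ≤ #{S ∈ 𝓢 | P ≤ S}
    · have hne' : 𝓢.Nonempty := by
        obtain ⟨P, hPm⟩ := hne
        have h1 := hrich P hPm
        have h2 : 0 < C₁ * (Fintype.card F : ℝ) ^ r := by positivity
        have h3 : 0 < #{S ∈ 𝓢 | P ≤ S} := by exact_mod_cast h2.trans_le h1
        obtain ⟨S, hS⟩ := card_pos.1 h3
        exact ⟨S, (mem_filter.1 hS).1⟩
      have h := H F V X (m + 1) 𝓟 𝓢 hne' h𝓟 (fun S hS => (mem_filter.1 hS).2.1) ?_ ?_ hrich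
      · refine le_trans ?_ h
        rw [show m + 1 + 2 + r = m + 2 + (r + 1) by ring]
        gcongr
        exact min_le_left _ _
      · intro S hS
        obtain ⟨-, hS1, hS2⟩ := mem_filter.1 hS
        refine (card_union_ge_of_many X m ha hq {P ∈ 𝓟 | P ≤ S}
          (fun Q hQ => h𝓟 Q (mem_filter.1 hQ).1) (fun Q hQ => hX Q (mem_filter.1 hQ).1)
          hS2).trans ?_
        refine mod_cast card_le_card fun x hx => ?_
        simp only [mem_filter] at hx ⊢
        obtain ⟨hx, Q, ⟨-, hQS⟩, hxQ⟩ := hx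
        exact ⟨hx, hQS hxQ⟩
      · intro S hS
        refine le_trans ?_ (mem_filter.1 hS).2.2
        exact mul_le_mul_of_nonneg_right (by nlinarith) (by positivity)
    · push Not at hrich
      obtain ⟨P, hPm, hPfew⟩ := hrich
      obtain ⟨𝓨', h𝓨'sub, h𝓨'card⟩ := exists_subset_card_eq (Nat.ceil_le.2 (hP P hPm))
      have h𝓨'mem : ∀ Y ∈ 𝓨', Y ∈ 𝓨 ∧ Y ≤ P := fun Y hY' => mem_filter.1 (h𝓨'sub hY')
      have hYlow : a * Fintype.card F ≤ #𝓨' := by rw [h𝓨'card]; exact Nat.le_ceil _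
      have hYup : (#𝓨' : ℝ) ≤ 2 * Fintype.card F := by
        rw [h𝓨'card]
        have := (Nat.ceil_lt_add_one (by positivity : 0 ≤ a * (Fintype.card F : ℝ))).le
        nlinarith
      set C : ℝ := max 2 (16 * C₁ / a) with hC
      have hC2 : 2 ≤ C := le_max_left _ _
      have hCC : 16 * C₁ ≤ C * a := by
        rw [← div_le_iff₀ ha]; exact le_max_right _ _
      set 𝓜 : Finset (Submodule F V) := {Q ∈ 𝓟 | Q ≠ P ∧ ∃ Y ∈ 𝓨', Y ≤ Q} with h𝓜
      have hq1 : (1 : ℝ) ≤ (Fintype.card F : ℝ) ^ (r + 1) := one_le_pow₀ (by linarith)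
      have hMcard : #𝓨' * (C / 2 * (Fintype.card F : ℝ) ^ (r + 1)) ≤ #𝓜 := by
        refine card_neighbours_ge m P (h𝓟 P hPm) 𝓨' 𝓟
          (fun Y hY' => ⟨h𝓨 Y (h𝓨'mem Y hY').1, (h𝓨'mem Y hY').2⟩) h𝓟 _ fun Y hY' => ?_
        refine le_trans ?_ (hY Y (h𝓨'mem Y hY').1)
        nlinarith
      have hMsup : ∀ Q ∈ 𝓜, finrank F (P ⊔ Q : Submodule F V) = m + 2 := by
        intro Q hQ
        obtain ⟨hQ, hQP, Y, hY', hYQ⟩ := mem_filter.1 hQ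
        exact finrank_sup_of_finrank_succ (Ne.symm hQP) (h𝓟 P hPm) (h𝓟 Q hQ)
          (h𝓨 Y (h𝓨'mem Y hY').1) (h𝓨'mem Y hY').2 hYQ
      have hsplit := card_filter_add_card_filter_not (s := 𝓜) (fun Q => P ⊔ Q ∈ 𝓢)
      have hMrich : (#{Q ∈ 𝓜 | P ⊔ Q ∈ 𝓢} : ℝ) ≤ 4 * C₁ * (Fintype.card F : ℝ) ^ (r + 2) := by
        have hsub : ({Q ∈ 𝓜 | P ⊔ Q ∈ 𝓢} : Finset _) ⊆
            ({S ∈ 𝓢 | P ≤ S} ×ˢ 𝓨').biUnion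
              fun SY => {Q ∈ 𝓜 | SY.2 ≤ Q ∧ Q ≤ SY.1} := by
          intro Q hQ
          obtain ⟨hQM, hQS⟩ := mem_filter.1 hQ
          obtain ⟨hQ, hQP, Y, hY', hYQ⟩ := mem_filter.1 hQM
          simp only [mem_biUnion, mem_product, mem_filter, Prod.exists]
          exact ⟨P ⊔ Q, Y, ⟨⟨hQS, le_sup_left⟩, hY'⟩, hQM, hYQ, le_sup_right⟩
        have hle : #{Q ∈ 𝓜 | P ⊔ Q ∈ 𝓢} ≤
            #({S ∈ 𝓢 | P ≤ S} ×ˢ 𝓨') * (2 * Fintype.card F) := by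
          refine (card_le_card hsub).trans (card_biUnion_le_card_mul _ _ _ fun SY hSY => ?_)
          obtain ⟨hS, hY'⟩ := mem_product.1 hSY
          have := card_pencil_le m SY.2 SY.1 (h𝓨 _ (h𝓨'mem _ hY').1)
            (mem_filter.1 (mem_filter.1 hS).1).2.1 {Q ∈ 𝓜 | SY.2 ≤ Q ∧ Q ≤ SY.1}
            (fun Q hQ => ⟨h𝓟 Q (mem_filter.1 (mem_filter.1 hQ).1).1, (mem_filter.1 hQ).2⟩)
          exact_mod_cast this
        rw [card_product] at hle
        have hle' : (#{Q ∈ 𝓜 | P ⊔ Q ∈ 𝓢} : ℝ) ≤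
            #{S ∈ 𝓢 | P ≤ S} * #𝓨' * (2 * Fintype.card F) := by exact_mod_cast hle
        refine hle'.trans ?_
        calc (#{S ∈ 𝓢 | P ≤ S} * #𝓨' * (2 * Fintype.card F) : ℝ)
            ≤ (C₁ * (Fintype.card F : ℝ) ^ r) * (2 * Fintype.card F) * (2 * Fintype.card F) := by
              gcongr
          _ = _ := by ring
      set 𝓑 : Finset (Submodule F V) := {Q ∈ 𝓜 | ¬ P ⊔ Q ∈ 𝓢} with h𝓑
      have hB : a / 2 * (Fintype.card F : ℝ) ^ (r + 2) ≤ #𝓑 := by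
        have h1 : (#{Q ∈ 𝓜 | P ⊔ Q ∈ 𝓢} : ℝ) + #𝓑 = #𝓜 := by exact_mod_cast hsplit
        have h2 : a * C / 2 * (Fintype.card F : ℝ) ^ (r + 2) ≤ #𝓜 := by
          refine le_trans (le_of_eq ?_) ((mul_le_mul_of_nonneg_right hYlow ?_).trans hMcard)
          · ring
          · positivity
        have h3 : (0 : ℝ) ≤ (Fintype.card F : ℝ) ^ (r + 2) := by positivity
        have h4 : a / 2 ≤ a * C / 2 - 4 * C₁ := by nlinarith
        have h5 := mul_le_mul_of_nonneg_right h4 h3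
        linarith
      have hBsum : #𝓑 = ∑ S ∈ 𝓑.image (P ⊔ ·), #{Q ∈ 𝓑 | P ⊔ Q = S} :=
        card_eq_sum_card_image _ _
      have hpts : ∑ S ∈ 𝓑.image (P ⊔ ·), #{x ∈ X | x ∈ S ∧ x ∉ P} ≤ #X := by
        refine (sum_card_diff_le X (m + 1) P ⊤ (h𝓟 P hPm) _ fun S hS => ?_).trans
          (card_filter_le _ _)
        obtain ⟨Q, hQ, rfl⟩ := mem_image.1 hS
        exact ⟨hMsup Q (mem_filter.1 hQ).1, le_sup_left, le_top⟩
      have hfew : ∀ S ∈ 𝓑.image (P ⊔ ·),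
          a / 4 * (Fintype.card F : ℝ) ^ (m + 1) * #{Q ∈ 𝓑 | P ⊔ Q = S}
            ≤ #{x ∈ X | x ∈ S ∧ x ∉ P} := by
        intro S hS
        refine card_union_diff_ge_of_few X m ha hq P S (h𝓟 P hPm) _ ?_ ?_ ?_
        · intro Q hQ
          obtain ⟨hQB, rfl⟩ := mem_filter.1 hQ
          have hQ' := mem_filter.1 (mem_filter.1 hQB).1
          exact ⟨h𝓟 Q hQ'.1, hQ'.2.1, le_sup_right⟩
        · intro Q hQ
          exact hX Q (mem_filter.1 (mem_filter.1 (mem_filter.1 hQ).1).1).1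
        · obtain ⟨Q, hQ, rfl⟩ := mem_image.1 hS
          obtain ⟨hQM, hQS⟩ := mem_filter.1 hQ
          have h1 : ¬ a / 4 * Fintype.card F ≤ #{R ∈ 𝓟 | R ≤ P ⊔ Q} := fun h =>
            hQS (mem_filter.2 ⟨mem_univ _, hMsup Q hQM, h⟩)
          refine le_trans ?_ (not_le.1 h1).le
          refine mod_cast card_le_card fun R hR => ?_
          obtain ⟨hR, hRQ⟩ := mem_filter.1 hR
          refine mem_filter.2 ⟨(mem_filter.1 (mem_filter.1 hR).1).1, ?_⟩
          rw [← hRQ]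
          exact le_sup_right
      have hfinal : a / 4 * (Fintype.card F : ℝ) ^ (m + 1) * #𝓑 ≤ #X := by
        rw [hBsum]
        push_cast
        rw [mul_sum]
        refine (sum_le_sum hfew).trans ?_
        exact_mod_cast hpts
      refine le_trans ?_ hfinal
      calc min c₁ (min (a * (a / 4) ^ (r + 2)) (a ^ 2 / 8))
            * (Fintype.card F : ℝ) ^ (m + 2 + (r + 1))
          ≤ a ^ 2 / 8 * (Fintype.card F : ℝ) ^ (m + 2 + (r + 1)) := by
            gcongr
            exact (min_le_right _ _).trans (min_le_right _ _)
        _ = a / 4 * (Fintype.card F : ℝ) ^ (m + 1)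
            * (a / 2 * (Fintype.card F : ℝ) ^ (r + 2)) := by ring
        _ ≤ _ := by gcongr

end RichChain

section Frames

open Module Finset
open scoped Classical

lemma exists_subset_forall_le_card_fiber {α β ι : Type*} [Fintype ι] [DecidableEq β] (S : Finset α)
    (π : ι → α → β) (t : ι → ℝ) (ht : ∀ i, 0 ≤ t i)
    (h : ∑ i, t i * #(S.image (π i)) < #S) :
    ∃ T ⊆ S, T.Nonempty ∧ ∀ x ∈ T, ∀ i, t i ≤ #{y ∈ T | π i y = π i x} := by
  obtain ⟨T, hTS, hT⟩ := exists_max_image S.powerset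
    (fun T => (#T : ℝ) - ∑ i, t i * #(T.image (π i))) ⟨S, mem_powerset_self S⟩
  rw [mem_powerset] at hTS
  refine ⟨T, hTS, ?_, ?_⟩
  · rw [nonempty_iff_ne_empty]
    rintro rfl
    have := hT S (mem_powerset_self S)
    simp only [card_empty, Nat.cast_zero, image_empty, mul_zero, sum_const_zero] at this
    linarith
  · intro x hx i
    by_contra! hlt
    have h1 := hT {y ∈ T | ¬ π i y = π i x} (mem_powerset.2 ((filter_subset _ _).trans hTS))
    have h2 : (#{y ∈ T | π i y = π i x} : ℝ) + #{y ∈ T | ¬ π i y = π i x} = #T := by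
      exact_mod_cast card_filter_add_card_filter_not (s := T) (fun y => π i y = π i x)
    have h3 : ∀ j ∈ univ.erase i, t j * (#({y ∈ T | ¬ π i y = π i x}.image (π j)) : ℝ)
        ≤ t j * #(T.image (π j)) := fun j _ =>
      mul_le_mul_of_nonneg_left
        (mod_cast card_le_card (image_subset_image (filter_subset _ _))) (ht j)
    have h4 : t i * (#({y ∈ T | ¬ π i y = π i x}.image (π i)) + 1 : ℝ)
        ≤ t i * #(T.image (π i)) := by
      refine mul_le_mul_of_nonneg_left ?_ (ht i)
      have hsub : {y ∈ T | ¬ π i y = π i x}.image (π i) ⊆ (T.image (π i)).erase (π i x) := by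
        intro z hz
        obtain ⟨y, hy, rfl⟩ := mem_image.1 hz
        exact mem_erase.2 ⟨(mem_filter.1 hy).2, mem_image_of_mem _ (mem_filter.1 hy).1⟩
      have := card_le_card hsub
      rw [card_erase_of_mem (mem_image_of_mem _ hx)] at this
      have hpos : 0 < #(T.image (π i)) := card_pos.2 ⟨_, mem_image_of_mem _ hx⟩
      exact_mod_cast (by omega : #({y ∈ T | ¬ π i y = π i x}.image (π i)) + 1
        ≤ #(T.image (π i)))
    have h5 := sum_le_sum h3
    rw [← add_sum_erase univ _ (mem_univ i), ← add_sum_erase univ _ (mem_univ i)] at h1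
    linarith

lemma card_mul_le_card_of_forall_fiber {α β : Type*} (A : Finset α) (B : Finset β) (p : β → α)
    (N : ℝ) (h : ∀ a ∈ A, N ≤ #{b ∈ B | p b = a}) : #A * N ≤ #B := by
  have h1 : ∑ a ∈ A, #{b ∈ B | p b = a} ≤ #B := by
    rw [← card_biUnion]
    · exact card_le_card (biUnion_subset.2 fun a _ => filter_subset _ _)
    · intro a _ b _ hab
      rw [Function.onFun, disjoint_left]
      intro x hx hx'
      exact hab ((mem_filter.1 hx).2.symm.trans (mem_filter.1 hx').2)
  calc (#A : ℝ) * N ≤ ∑ a ∈ A, (#{b ∈ B | p b = a} : ℝ) := by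
        rw [← nsmul_eq_mul]; exact card_nsmul_le_sum _ _ _ h
    _ ≤ #B := by exact_mod_cast h1

lemma pow_le_card_of_forall_update {V : Type*} [Fintype V] {N : ℝ} (hN : 0 ≤ N) (m : ℕ) :
    ∀ G : Finset (Fin m → V), G.Nonempty →
      (∀ g ∈ G, ∀ j, N ≤ #{w : V | Function.update g j w ∈ G}) → N ^ m ≤ #G := by
  induction m with
  | zero =>
    intro G hG _
    simpa using hG.card_pos
  | succ m ih =>
    intro G hG h
    have h1 := ih (G.image fun g => (Fin.init g : Fin m → V)) (hG.image _) ?_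
    · rw [pow_succ]
      refine (mul_le_mul_of_nonneg_right h1 hN).trans ?_
      refine card_mul_le_card_of_forall_fiber _ _
        (fun g : Fin (m + 1) → V => (Fin.init g : Fin m → V)) N fun a ha => ?_
      obtain ⟨g, hg, rfl⟩ := mem_image.1 ha
      refine (h g hg (Fin.last m)).trans ?_
      refine mod_cast card_le_card_of_injOn (fun w => Function.update g (Fin.last m) w) ?_ ?_
      · intro w hw
        simp only [coe_filter, mem_univ, true_and, Set.mem_ofPred_eq] at hw ⊢
        exact ⟨hw, Fin.init_update_last _ _⟩
      · exact (Function.update_injective g _).injOn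
    · intro a ha j
      obtain ⟨g, hg, rfl⟩ := mem_image.1 ha
      refine (h g hg j.castSucc).trans ?_
      refine mod_cast card_le_card fun w hw => ?_
      simp only [mem_filter, mem_univ, true_and] at hw ⊢
      rw [← Fin.init_update_castSucc]
      exact mem_image_of_mem _ hw

variable {F V : Type} [Field F] [AddCommGroup V] [Module F V] [Fintype F] [Fintype V]

lemma card_frames_ge {K : ℕ} (W H : Submodule F V) (hW : finrank F W = K) (hWH : ¬ W ≤ H) :
    ∀ j ≤ K, ((Fintype.card F : ℝ) ^ K / 2) ^ j ≤
      #{f : Fin j → V | LinearIndependent F f ∧ (∀ i, f i ∈ W) ∧ ∀ i, i.val = 0 → f i ∉ H} := by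
  intro j
  induction j with
  | zero =>
    intro _
    have : #{f : Fin 0 → V | LinearIndependent F f ∧ (∀ i, f i ∈ W) ∧
        ∀ i, i.val = 0 → f i ∉ H} = 1 := by
      rw [filter_true_of_mem]
      · simp
      · intro f _
        exact ⟨linearIndependent_empty_type, fun i => i.elim0, fun i => i.elim0⟩
    rw [this]
    simp
  | succ j ih =>
    intro hj
    rw [pow_succ]
    refine (mul_le_mul_of_nonneg_right (ih (by omega)) (by positivity)).trans ?_
    refine card_mul_le_card_of_forall_fiber _ _
      (fun g : Fin (j + 1) → V => (Fin.init g : Fin j → V)) _ fun f hf => ?_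
    obtain ⟨-, hfli, hfW, hfH⟩ := mem_filter.1 hf
    obtain ⟨E, hE, hEspan, hEH⟩ : ∃ E : Submodule F V, ¬ W ≤ E ∧
        Submodule.span F (Set.range f) ≤ E ∧ (j = 0 → H ≤ E) := by
      rcases Nat.eq_zero_or_pos j with rfl | hjpos
      · refine ⟨H, hWH, ?_, fun _ => le_rfl⟩
        rw [Submodule.span_le]
        rintro _ ⟨i, rfl⟩
        exact i.elim0
      · refine ⟨_, fun hle => ?_, le_rfl, by omega⟩
        have h1 := Submodule.finrank_mono hle
        rw [finrank_span_eq_card hfli, hW, Fintype.card_fin] at h1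
        omega
    have hcount : (Fintype.card F : ℝ) ^ K / 2 ≤ #{w : V | w ∈ W ∧ w ∉ W ⊓ E} := by
      have h1 := card_filter_diff_ge (univ : Finset V) (W ⊓ E) W
      rw [card_univ_filter_mem, hW] at h1
      push_cast at h1
      refine le_trans ?_ h1
      have hlt : finrank F (W ⊓ E : Submodule F V) < K := by
        rw [← hW]
        exact Submodule.finrank_lt_finrank_of_lt
          (lt_of_le_of_ne inf_le_left fun h => hE (inf_eq_left.1 h))
      have hq : (2 : ℝ) ≤ Fintype.card F := two_le_card_field
      have h2 : (Fintype.card F : ℝ) ^ (finrank F (W ⊓ E : Submodule F V) + 1)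
          ≤ (Fintype.card F : ℝ) ^ K := pow_le_pow_right₀ (by linarith) hlt
      have h3 : (0 : ℝ) ≤ (Fintype.card F : ℝ) ^ (finrank F (W ⊓ E : Submodule F V)) := by
        positivity
      rw [pow_succ] at h2
      nlinarith
    refine hcount.trans ?_
    refine mod_cast card_le_card_of_injOn (fun w => (Fin.snoc f w : Fin (j + 1) → V)) ?_ ?_
    · intro w hw
      simp only [coe_filter, mem_univ, true_and, Set.mem_ofPred_eq, Submodule.mem_inf,
        mem_filter] at hw ⊢
      have hwE : w ∉ E := fun h => hw.2 ⟨hw.1, h⟩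
      refine ⟨⟨linearIndependent_finSnoc.2 ⟨hfli, fun h => hwE (hEspan h)⟩, ?_, ?_⟩,
        Fin.init_snoc _ _⟩
      · intro i
        refine Fin.lastCases ?_ (fun i => ?_) i
        · simpa using hw.1
        · simpa using hfW i
      · intro i
        refine Fin.lastCases ?_ (fun i => ?_) i
        · intro h0
          have : j = 0 := by simpa using h0
          simpa using fun h => hwE (hEH this h)
        · intro h0
          have h0' : (i : ℕ) = 0 := by simpa using congrArg Fin.val h0
          simpa using hfH i h0'
    · intro w _ w' _ h
      have := congrFun h (Fin.last j)
      simpa using this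

lemma card_span_update_ge {k r : ℕ} {a C c : ℝ}
    (hrich : ∀ (X : Finset V) (m : ℕ) (𝓨 𝓟 : Finset (Submodule F V)), 𝓟.Nonempty →
        (∀ Y ∈ 𝓨, finrank F Y = m) → (∀ P ∈ 𝓟, finrank F P = m + 1) →
        (∀ P ∈ 𝓟, a * (Fintype.card F : ℝ) ^ (m + 1) ≤ #{x ∈ X | x ∈ P}) →
        (∀ P ∈ 𝓟, a * (Fintype.card F : ℝ) ≤ #{Y ∈ 𝓨 | Y ≤ P}) →
        (∀ Y ∈ 𝓨, C * (Fintype.card F : ℝ) ^ r ≤ #{P ∈ 𝓟 | Y ≤ P}) →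
        c * (Fintype.card F : ℝ) ^ (m + 2 + r) ≤ #X)
    (T : Finset (Fin (k + 1) → V)) (hT : ∀ f ∈ T, LinearIndependent F f) (i : Fin k)
    (h1 : ∀ g ∈ T, a * (Fintype.card F : ℝ) ^ (k + 1) ≤
      #{w : V | Function.update g i.castSucc w ∈ T ∧
        Submodule.span F (Set.range (Function.update g i.castSucc w)) =
          Submodule.span F (Set.range g)})
    (h2 : ∀ g ∈ T, C * (Fintype.card F : ℝ) ^ (k + 1 + r) ≤
      #{w : V | Function.update g (Fin.last k) w ∈ T})
    (f : Fin (k + 1) → V) (hf : f ∈ T) :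
    c * (Fintype.card F : ℝ) ^ (k + 2 + r) ≤
      #{w : V | ∃ w', Function.update (Function.update f i.castSucc w) (Fin.last k) w' ∈ T} := by
  have hq0 : (0 : ℝ) < Fintype.card F := by linarith [two_le_card_field (F := F)]
  set 𝓖 : Finset (Fin (k + 1) → V) :=
    {g ∈ T | ∀ l, l ≠ i.castSucc → l ≠ Fin.last k → g l = f l} with h𝓖
  have hf𝓖 : f ∈ 𝓖 := mem_filter.2 ⟨hf, fun _ _ _ => rfl⟩
  have hne : i.castSucc ≠ Fin.last k := (Fin.castSucc_lt_last i).ne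
  have hup1 : ∀ g ∈ 𝓖, ∀ w, Function.update g i.castSucc w ∈ T →
      Function.update g i.castSucc w ∈ 𝓖 := by
    intro g hg w hw
    refine mem_filter.2 ⟨hw, fun l hl hl' => ?_⟩
    rw [Function.update_of_ne hl]
    exact (mem_filter.1 hg).2 l hl hl'
  have hup2 : ∀ g ∈ 𝓖, ∀ w, Function.update g (Fin.last k) w ∈ T →
      Function.update g (Fin.last k) w ∈ 𝓖 := by
    intro g hg w hw
    refine mem_filter.2 ⟨hw, fun l hl hl' => ?_⟩
    rw [Function.update_of_ne hl']
    exact (mem_filter.1 hg).2 l hl hl'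
  have hinit_le : ∀ g : Fin (k + 1) → V, Submodule.span F (Set.range (Fin.init g : Fin k → V)) ≤
      Submodule.span F (Set.range g) := fun g =>
    Submodule.span_mono (by rintro _ ⟨l, rfl⟩; exact ⟨l.castSucc, rfl⟩)
  have hinit_li : ∀ g ∈ T, LinearIndependent F (Fin.init g : Fin k → V) := fun g hg =>
    (hT g hg).comp _ (Fin.castSucc_injective k)
  have hmain := hrich (𝓖.image fun g => g i.castSucc) k
    (𝓖.image fun g => Submodule.span F (Set.range (Fin.init g : Fin k → V)))
    (𝓖.image fun g => Submodule.span F (Set.range g)) ⟨_, mem_image_of_mem _ hf𝓖⟩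
    ?_ ?_ ?_ ?_ ?_
  · refine hmain.trans (mod_cast card_le_card fun x hx => ?_)
    obtain ⟨g, hg, rfl⟩ := mem_image.1 hx
    refine mem_filter.2 ⟨mem_univ _, g (Fin.last k), ?_⟩
    convert (mem_filter.1 hg).1 using 1
    ext l
    by_cases hl : l = Fin.last k
    · subst hl; simp
    · rw [Function.update_of_ne hl]
      by_cases hl' : l = i.castSucc
      · subst hl'; simp
      · rw [Function.update_of_ne hl']
        exact ((mem_filter.1 hg).2 l hl' hl).symm
  · intro Y hY
    obtain ⟨g, hg, rfl⟩ := mem_image.1 hY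
    rw [finrank_span_eq_card (hinit_li g (mem_filter.1 hg).1), Fintype.card_fin]
  · intro P hP
    obtain ⟨g, hg, rfl⟩ := mem_image.1 hP
    rw [finrank_span_eq_card (hT g (mem_filter.1 hg).1), Fintype.card_fin]
  · intro P hP
    obtain ⟨g, hg, rfl⟩ := mem_image.1 hP
    refine (h1 g (mem_filter.1 hg).1).trans (mod_cast card_le_card fun w hw => ?_)
    obtain ⟨-, hwT, hws⟩ := mem_filter.1 hw
    refine mem_filter.2 ⟨mem_image.2 ⟨_, hup1 g hg w hwT, by simp⟩, ?_⟩
    rw [← hws]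
    exact Submodule.subset_span ⟨i.castSucc, by simp⟩
  · intro P hP
    obtain ⟨g, hg, rfl⟩ := mem_image.1 hP
    set 𝓨 := 𝓖.image fun g => Submodule.span F (Set.range (Fin.init g : Fin k → V)) with h𝓨
    have hle : #{w : V | Function.update g i.castSucc w ∈ T ∧
        Submodule.span F (Set.range (Function.update g i.castSucc w)) =
          Submodule.span F (Set.range g)} ≤
        #{Y ∈ 𝓨 | Y ≤ Submodule.span F (Set.range g)} * Fintype.card F ^ k := by
      refine (card_le_card fun w hw => ?_).trans
        (card_biUnion_le_card_mul {Y ∈ 𝓨 | Y ≤ Submodule.span F (Set.range g)}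
          (fun Y => {x : V | x ∈ Y}) _ fun Y hY => ?_)
      · obtain ⟨-, hwT, hws⟩ := mem_filter.1 hw
        refine mem_biUnion.2 ⟨_, mem_filter.2 ⟨mem_image_of_mem _ (hup1 g hg w hwT), ?_⟩, ?_⟩
        · rw [← hws]; exact hinit_le _
        · refine mem_filter.2 ⟨mem_univ _, Submodule.subset_span ⟨i, ?_⟩⟩
          simp [Fin.init]
      · obtain ⟨g', hg', rfl⟩ := mem_image.1 (mem_filter.1 hY).1
        rw [card_univ_filter_mem, finrank_span_eq_card (hinit_li g' (mem_filter.1 hg').1),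
          Fintype.card_fin]
    have h3 : a * (Fintype.card F : ℝ) ^ (k + 1) ≤
        #{Y ∈ 𝓨 | Y ≤ Submodule.span F (Set.range g)} * (Fintype.card F : ℝ) ^ k :=
      (h1 g (mem_filter.1 hg).1).trans (mod_cast hle)
    refine le_of_mul_le_mul_right (le_trans (le_of_eq ?_) h3) (pow_pos hq0 k)
    ring
  · intro Y hY
    obtain ⟨g, hg, rfl⟩ := mem_image.1 hY
    set 𝓟 := 𝓖.image fun g => Submodule.span F (Set.range g) with h𝓟
    have hle : #{w : V | Function.update g (Fin.last k) w ∈ T} ≤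
        #{P ∈ 𝓟 | Submodule.span F (Set.range (Fin.init g : Fin k → V)) ≤ P} *
          Fintype.card F ^ (k + 1) := by
      refine (card_le_card fun w hw => ?_).trans
        (card_biUnion_le_card_mul
          {P ∈ 𝓟 | Submodule.span F (Set.range (Fin.init g : Fin k → V)) ≤ P}
          (fun Y => {x : V | x ∈ Y}) _ fun P hP => ?_)
      · obtain ⟨-, hwT⟩ := mem_filter.1 hw
        refine mem_biUnion.2 ⟨_, mem_filter.2 ⟨mem_image_of_mem _ (hup2 g hg w hwT), ?_⟩, ?_⟩
        · refine le_trans (le_of_eq ?_) (hinit_le _)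
          rw [Fin.init_update_last]
        · exact mem_filter.2 ⟨mem_univ _, Submodule.subset_span ⟨Fin.last k, by simp⟩⟩
      · obtain ⟨g', hg', rfl⟩ := mem_image.1 (mem_filter.1 hP).1
        rw [card_univ_filter_mem, finrank_span_eq_card (hT g' (mem_filter.1 hg').1),
          Fintype.card_fin]
    have h3 : C * (Fintype.card F : ℝ) ^ (k + 1 + r) ≤
        #{P ∈ 𝓟 | Submodule.span F (Set.range (Fin.init g : Fin k → V)) ≤ P} *
          (Fintype.card F : ℝ) ^ (k + 1) :=
      (h2 g (mem_filter.1 hg).1).trans (mod_cast hle)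
    refine le_of_mul_le_mul_right (le_trans (le_of_eq ?_) h3) (pow_pos hq0 (k + 1))
    ring

end Frames

section Shadow

open Module Finset
open scoped Classical

section Counting

lemma thresholds_sum_lt {k r : ℕ} {q C l s : ℝ} (hk : (0 : ℝ) < k) (hq : 0 < q) (hl : 0 ≤ l)
    (hlt : C * (s * q ^ (k + 1 + r)) < 1 / (2 * 2 ^ (k + 1)) * (l * q ^ (2 * k + 1))) :
    k * (1 / (4 * k * 2 ^ (k + 1)) * q ^ (k + 1) * (l * (q ^ (k + 1)) ^ k)) +
      C * q ^ (k + 1 + r) * (s * (q ^ k) ^ k) < l * (q ^ (k + 1) / 2) ^ (k + 1) := by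
  have h1 := mul_lt_mul_of_pos_right hlt (pow_pos hq (k * k))
  set M : ℝ := l * q ^ (2 * k + 1) * q ^ (k * k) / 2 ^ (k + 1) with hM
  have hM0 : 0 ≤ M := by positivity
  have h2 : k * (1 / (4 * k * 2 ^ (k + 1)) * q ^ (k + 1) * (l * (q ^ (k + 1)) ^ k)) = M / 4 := by
    rw [hM]
    field_simp
    ring
  have h3 : l * (q ^ (k + 1) / 2) ^ (k + 1) = M := by
    rw [hM, div_pow]
    ring
  have h4 : C * q ^ (k + 1 + r) * (s * (q ^ k) ^ k) =
      C * (s * q ^ (k + 1 + r)) * q ^ (k * k) := by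
    rw [← pow_mul]
    ring
  have h5 : 1 / (2 * 2 ^ (k + 1)) * (l * q ^ (2 * k + 1)) * q ^ (k * k) = M / 2 := by
    rw [hM]
    field_simp
  rw [h2, h3, h4]
  rw [h5] at h1
  linarith

variable {F V : Type} [Field F] [AddCommGroup V] [Module F V] [Fintype F] [Fintype V]

lemma card_frames_family_ge {K : ℕ} (H : Submodule F V) (L : Finset (Submodule F V))
    (hL : ∀ W ∈ L, finrank F W = K ∧ ¬ W ≤ H) :
    #L * ((Fintype.card F : ℝ) ^ K / 2) ^ K ≤
      #{f : Fin K → V | LinearIndependent F f ∧ Submodule.span F (Set.range f) ∈ L ∧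
        ∀ i, i.val = 0 → f i ∉ H} := by
  refine card_mul_le_card_of_forall_fiber _ _
    (fun f : Fin K → V => Submodule.span F (Set.range f)) _ fun W hW => ?_
  refine (card_frames_ge W H (hL W hW).1 (hL W hW).2 K le_rfl).trans
    (mod_cast card_le_card fun f hf => ?_)
  obtain ⟨-, hli, hfW, hfH⟩ := mem_filter.1 hf
  have hspan : Submodule.span F (Set.range f) = W := by
    refine Submodule.eq_of_le_of_finrank_eq (Submodule.span_le.2 ?_) ?_
    · rintro _ ⟨i, rfl⟩
      exact hfW i
    · rw [finrank_span_eq_card hli, Fintype.card_fin, (hL W hW).1]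
  refine mem_filter.2 ⟨mem_filter.2 ⟨mem_univ _, hli, ?_, hfH⟩, hspan⟩
  rwa [hspan]

lemma card_tuples_pair_le {k m : ℕ} (L : Finset (Submodule F V)) (hL : ∀ W ∈ L, finrank F W = k)
    (G : Finset ((Fin m → V) × Submodule F V)) (hG : ∀ g ∈ G, g.2 ∈ L ∧ ∀ i, g.1 i ∈ g.2) :
    (#G : ℝ) ≤ #L * ((Fintype.card F : ℝ) ^ k) ^ m := by
  have h : #G ≤ #L * (Fintype.card F ^ k) ^ m := by
    refine (card_le_card fun g hg => ?_).trans (card_biUnion_le_card_mul L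
      (fun W => (Fintype.piFinset fun _ : Fin m => {x : V | x ∈ W}) ×ˢ {W}) _ fun W hW => ?_)
    · refine mem_biUnion.2 ⟨g.2, (hG g hg).1, mem_product.2 ⟨?_, by simp⟩⟩
      exact Fintype.mem_piFinset.2 fun i => mem_filter.2 ⟨mem_univ _, (hG g hg).2 i⟩
    · rw [card_product, Fintype.card_piFinset_const, card_univ_filter_mem, hL W hW]
      simp
  exact_mod_cast h

lemma card_tuples_le {k m : ℕ} (S : Finset (Submodule F V)) (G : Finset (Fin m → V))
    (hG : ∀ g ∈ G, ∃ U ∈ S, finrank F U = k ∧ ∀ i, g i ∈ U) :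
    (#G : ℝ) ≤ #S * ((Fintype.card F : ℝ) ^ k) ^ m := by
  have h : #G ≤ #S * (Fintype.card F ^ k) ^ m := by
    refine (card_le_card fun g hg => ?_).trans ((card_biUnion_le_card_mul
      (S.filter fun U : Submodule F V => finrank F U = k)
      (fun W => (Fintype.piFinset fun _ : Fin m => {x : V | x ∈ W})) _ fun W hW => ?_).trans
      (Nat.mul_le_mul_right _ (card_le_card (filter_subset _ _))))
    · obtain ⟨U, hU, hUk, hgU⟩ := hG g hg
      refine mem_biUnion.2 ⟨U, mem_filter.2 ⟨hU, hUk⟩, ?_⟩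
      exact Fintype.mem_piFinset.2 fun i => mem_filter.2 ⟨mem_univ _, hgU i⟩
    · rw [Fintype.card_piFinset_const, card_univ_filter_mem, (mem_filter.1 hW).2]
  exact_mod_cast h

lemma exists_pruned_frames {k r : ℕ} (hk : 1 ≤ k) {a C : ℝ} (ha : a = 1 / (4 * k * 2 ^ (k + 1)))
    (hC : 0 < C) (H : Submodule F V) (L S : Finset (Submodule F V))
    (hL : ∀ W ∈ L, finrank F W = k + 1 ∧ ¬ W ≤ H)
    (hS : ∀ U : Submodule F V, finrank F U = k → ¬ U ≤ H → (∃ W ∈ L, U ≤ W) → U ∈ S)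
    (hlt : C * (#S * (Fintype.card F : ℝ) ^ (k + 1 + r)) <
      1 / (2 * 2 ^ (k + 1)) * (#L * (Fintype.card F : ℝ) ^ (2 * k + 1))) :
    ∃ T : Finset (Fin (k + 1) → V), T.Nonempty ∧
      (∀ f ∈ T, LinearIndependent F f ∧
        Submodule.span F (Set.range (Fin.init f : Fin k → V)) ∈ S) ∧
      (∀ f ∈ T, ∀ i : Fin k, a * (Fintype.card F : ℝ) ^ (k + 1) ≤
        #{w : V | Function.update f i.castSucc w ∈ T ∧
          Submodule.span F (Set.range (Function.update f i.castSucc w)) =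
            Submodule.span F (Set.range f)}) ∧
      ∀ f ∈ T, C * (Fintype.card F : ℝ) ^ (k + 1 + r) ≤
        #{w : V | Function.update f (Fin.last k) w ∈ T} := by
  have hq0 : (0 : ℝ) < Fintype.card F := by linarith [two_le_card_field (F := F)]
  have hk0 : (0 : ℝ) < k := by exact_mod_cast hk
  have ha0 : 0 < a := by rw [ha]; positivity
  set 𝓕 : Finset (Fin (k + 1) → V) := {f | LinearIndependent F f ∧
    Submodule.span F (Set.range f) ∈ L ∧ ∀ i, i.val = 0 → f i ∉ H} with h𝓕
  have hS𝓕 : ∀ f ∈ 𝓕, finrank F (Submodule.span F (Set.range (Fin.init f : Fin k → V))) = k ∧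
      Submodule.span F (Set.range (Fin.init f : Fin k → V)) ∈ S := by
    intro f hf
    obtain ⟨-, hli, hfL, hfH⟩ := mem_filter.1 hf
    have hfin : finrank F (Submodule.span F (Set.range (Fin.init f : Fin k → V))) = k :=
      (finrank_span_eq_card (hli.comp _ (Fin.castSucc_injective k))).trans (Fintype.card_fin k)
    refine ⟨hfin, hS _ hfin (fun hle => ?_) ⟨_, hfL, Submodule.span_mono ?_⟩⟩
    · exact hfH (Fin.castSucc ⟨0, hk⟩) rfl (hle (Submodule.subset_span ⟨⟨0, hk⟩, rfl⟩))
    · rintro _ ⟨l, rfl⟩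
      exact ⟨l.castSucc, rfl⟩
  let π : Fin (k + 1) → (Fin (k + 1) → V) → (Fin k → V) × Submodule F V := fun j f =>
    (j.removeNth f, if j = Fin.last k then ⊥ else Submodule.span F (Set.range f))
  let t : Fin (k + 1) → ℝ := fun j => if j = Fin.last k then
    C * (Fintype.card F : ℝ) ^ (k + 1 + r) else a * (Fintype.card F : ℝ) ^ (k + 1)
  have hne : ∀ i : Fin k, i.castSucc ≠ Fin.last k := fun i => (Fin.castSucc_lt_last i).ne
  have hrem : ∀ (j : Fin (k + 1)) (f g : Fin (k + 1) → V), π j g = π j f →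
      g = Function.update f j (g j) := by
    intro j f g h
    have h' : (j.removeNth g : Fin k → V) = j.removeNth f := congrArg Prod.fst h
    ext l
    rcases Fin.eq_self_or_eq_succAbove j l with rfl | ⟨l, rfl⟩
    · simp
    · rw [Function.update_of_ne (Fin.succAbove_ne j l)]
      exact congrFun h' l
  have hsum : ∑ j, t j * #(𝓕.image (π j)) < #𝓕 := by
    have hcast : ∀ i : Fin k, t i.castSucc * #(𝓕.image (π i.castSucc)) ≤
        a * (Fintype.card F : ℝ) ^ (k + 1) * (#L * ((Fintype.card F : ℝ) ^ (k + 1)) ^ k) := by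
      intro i
      simp only [t, if_neg (hne i)]
      refine mul_le_mul_of_nonneg_left ?_ (by positivity)
      refine card_tuples_pair_le L (fun W hW => (hL W hW).1) _ fun g hg => ?_
      obtain ⟨f, hf, rfl⟩ := mem_image.1 hg
      simp only [π, if_neg (hne i)]
      exact ⟨(mem_filter.1 hf).2.2.1, fun l => Submodule.subset_span ⟨_, rfl⟩⟩
    have hlast : t (Fin.last k) * #(𝓕.image (π (Fin.last k))) ≤
        C * (Fintype.card F : ℝ) ^ (k + 1 + r) * (#S * ((Fintype.card F : ℝ) ^ k) ^ k) := by
      simp only [t, if_true]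
      refine mul_le_mul_of_nonneg_left ?_ (by positivity)
      have himage : 𝓕.image (π (Fin.last k)) =
          (𝓕.image fun f => (Fin.init f : Fin k → V)).image fun g => (g, ⊥) := by
        rw [image_image]
        refine image_congr fun f _ => ?_
        simp [π, Fin.removeNth_last]
      rw [himage]
      refine le_trans (mod_cast card_image_le) (card_tuples_le S _ fun g hg => ?_)
      obtain ⟨f, hf, rfl⟩ := mem_image.1 hg
      exact ⟨_, (hS𝓕 f hf).2, (hS𝓕 f hf).1, fun i => Submodule.subset_span ⟨i, rfl⟩⟩
    rw [Fin.sum_univ_castSucc]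
    refine (add_le_add (sum_le_sum fun i _ => hcast i) hlast).trans_lt ?_
    rw [sum_const, card_univ, Fintype.card_fin, nsmul_eq_mul]
    refine lt_of_lt_of_le ?_ (card_frames_family_ge H L hL)
    rw [ha]
    exact thresholds_sum_lt hk0 hq0 (by positivity) hlt
  obtain ⟨T, hT𝓕, hTne, hT⟩ := exists_subset_forall_le_card_fiber 𝓕 π t (fun j => by
    simp only [t]; split_ifs <;> positivity) hsum
  refine ⟨T, hTne, fun f hf => ⟨(mem_filter.1 (hT𝓕 hf)).2.1, (hS𝓕 f (hT𝓕 hf)).2⟩, ?_, ?_⟩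
  · intro f hf i
    have h := hT f hf i.castSucc
    simp only [t, if_neg (hne i)] at h
    refine h.trans (mod_cast card_le_card_of_injOn (fun g => g i.castSucc) ?_ ?_)
    · intro g hg
      obtain ⟨hgT, hgf⟩ := mem_filter.1 (mem_coe.1 hg)
      have hspan : Submodule.span F (Set.range g) = Submodule.span F (Set.range f) := by
        have := congrArg Prod.snd hgf
        simpa only [π, if_neg (hne i)] using this
      refine mem_coe.2 (mem_filter.2 ⟨mem_univ _, ?_⟩)
      rw [← hrem _ _ _ hgf]
      exact ⟨hgT, hspan⟩
    · intro g hg g' hg' h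
      rw [hrem _ _ _ (mem_filter.1 (mem_coe.1 hg)).2, hrem _ _ _ (mem_filter.1 (mem_coe.1 hg')).2]
      exact congrArg _ h
  · intro f hf
    have h := hT f hf (Fin.last k)
    simp only [t, if_true] at h
    refine h.trans (mod_cast card_le_card_of_injOn (fun g => g (Fin.last k)) ?_ ?_)
    · intro g hg
      obtain ⟨hgT, hgf⟩ := mem_filter.1 (mem_coe.1 hg)
      refine mem_coe.2 (mem_filter.2 ⟨mem_univ _, ?_⟩)
      rwa [← hrem _ _ _ hgf]
    · intro g hg g' hg' h
      rw [hrem _ _ _ (mem_filter.1 (mem_coe.1 hg)).2, hrem _ _ _ (mem_filter.1 (mem_coe.1 hg')).2]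
      exact congrArg _ h

end Counting

/-- A lower bound for the number of `k`-dimensional subspaces contained in the members of a family
of `(k + 1)`-dimensional subspaces, where only subspaces not contained in `H` are counted. -/
theorem card_shadow_ge (k r : ℕ) (hk : 1 ≤ k) : ∃ c : ℝ, 0 < c ∧
    ∀ (F V : Type) [Field F] [Fintype F] [AddCommGroup V] [Module F V] [Fintype V]
      (H : Submodule F V) (L S : Finset (Submodule F V)),
      (∀ W ∈ L, finrank F W = k + 1 ∧ ¬ W ≤ H) →
      (∀ U : Submodule F V, finrank F U = k → ¬ U ≤ H → (∃ W ∈ L, U ≤ W) → U ∈ S) →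
      c * (#L * (Fintype.card F : ℝ) ^ (2 * k + 1)) ≤
          #S * (Fintype.card F : ℝ) ^ (k + 1 + r) ∨
        c * (Fintype.card F : ℝ) ^ (k * (r + 2)) ≤ #S := by
  have hk0 : (1 : ℝ) ≤ k := by exact_mod_cast hk
  have ha1 : (1 : ℝ) / (4 * k * 2 ^ (k + 1)) ≤ 1 := by
    rw [div_le_one (by positivity)]
    have : (1 : ℝ) ≤ 2 ^ (k + 1) := one_le_pow₀ (by norm_num)
    nlinarith
  obtain ⟨C, c, hC, hc, hrich⟩ := card_ge_of_dense_incidences r (1 / (4 * k * 2 ^ (k + 1)))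
    (by positivity) ha1
  have hC0 : 0 < C := by linarith
  refine ⟨min (1 / (2 * 2 ^ (k + 1)) / C) (c ^ k), by positivity, ?_⟩
  intro F V _ _ _ _ _ H L S hL hS
  have hq0 : (0 : ℝ) < Fintype.card F := by linarith [two_le_card_field (F := F)]
  rcases lt_or_ge (C * (#S * (Fintype.card F : ℝ) ^ (k + 1 + r)))
    (1 / (2 * 2 ^ (k + 1)) * (#L * (Fintype.card F : ℝ) ^ (2 * k + 1))) with hlt | hge
  · right
    obtain ⟨T, hTne, hTS, h1, h2⟩ := exists_pruned_frames hk rfl hC0 H L S hL hS hlt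
    have hpow : (c * (Fintype.card F : ℝ) ^ (k + 2 + r)) ^ k ≤
        #(T.image fun f => (Fin.init f : Fin k → V)) := by
      refine pow_le_card_of_forall_update (by positivity) k _ (hTne.image _) fun g hg i => ?_
      obtain ⟨f, hf, rfl⟩ := mem_image.1 hg
      refine (card_span_update_ge (hrich F V) T (fun f hf => (hTS f hf).1) i
        (fun g hg => h1 g hg i) h2 f hf).trans (mod_cast card_le_card fun w hw => ?_)
      obtain ⟨-, w', hw'⟩ := mem_filter.1 hw
      refine mem_filter.2 ⟨mem_univ _, mem_image.2 ⟨_, hw', ?_⟩⟩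
      rw [Fin.init_update_last, Fin.init_update_castSucc]
    have hle : (#(T.image fun f => (Fin.init f : Fin k → V)) : ℝ) ≤
        #S * ((Fintype.card F : ℝ) ^ k) ^ k := by
      refine card_tuples_le S _ fun g hg => ?_
      obtain ⟨f, hf, rfl⟩ := mem_image.1 hg
      exact ⟨_, (hTS f hf).2, (finrank_span_eq_card
        ((hTS f hf).1.comp _ (Fin.castSucc_injective k))).trans (Fintype.card_fin k),
        fun i => Submodule.subset_span ⟨i, rfl⟩⟩
    have h3 := hpow.trans hle
    refine (mul_le_mul_of_nonneg_right (min_le_right _ _) (by positivity)).trans ?_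
    refine le_of_mul_le_mul_right (le_trans (le_of_eq ?_) h3)
      (pow_pos (pow_pos hq0 k) k)
    ring
  · left
    refine (mul_le_mul_of_nonneg_right (min_le_left _ _) (by positivity)).trans ?_
    rw [div_mul_eq_mul_div, div_le_iff₀ hC0]
    linarith

end Shadow

section Iterate

open Module Finset
open scoped Classical

lemma rpow_le_card_of_step {q c a β L S : ℝ} {k r D : ℕ} (hD : D = k + 1 + r) (hq : 1 ≤ q)
    (hc : 0 < c) (hβ : β ≤ k)
    (hL : a * q ^ (((k : ℝ) + 1) * (D - (k + 1)) + β) ≤ L)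
    (h : c * (L * q ^ (2 * k + 1)) ≤ S * q ^ (k + 1 + r) ∨ c * q ^ (k * (r + 2)) ≤ S) :
    min (c * a) c * q ^ ((k : ℝ) * (D - k) + β) ≤ S := by
  have hq0 : 0 < q := by linarith
  have hDr : (D : ℝ) = k + 1 + r := by rw [hD]; push_cast; ring
  rcases h with h | h
  · refine (mul_le_mul_of_nonneg_right (min_le_left _ _) (by positivity)).trans ?_
    refine le_of_mul_le_mul_right (le_trans ?_ h) (pow_pos hq0 (k + 1 + r))
    rw [← Real.rpow_natCast q (k + 1 + r), mul_assoc, ← Real.rpow_add hq0, mul_assoc]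
    refine mul_le_mul_of_nonneg_left (le_trans (le_of_eq ?_)
      (mul_le_mul_of_nonneg_right hL (pow_nonneg hq0.le (2 * k + 1)))) hc.le
    rw [← Real.rpow_natCast q (2 * k + 1), mul_assoc, ← Real.rpow_add hq0, hDr]
    congr 2
    push_cast
    ring
  · refine (mul_le_mul_of_nonneg_right (min_le_right _ _) (by positivity)).trans (le_trans ?_ h)
    rw [← Real.rpow_natCast q (k * (r + 2))]
    refine mul_le_mul_of_nonneg_left (Real.rpow_le_rpow_of_exponent_le hq ?_) hc.le
    rw [hDr]
    push_cast
    nlinarith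

/-- The linear form of the bound: descending from dimension `K' + m` to dimension `K'` one dimension
at a time. -/
theorem rpow_le_card_shadow (D K' : ℕ) (hK' : 1 ≤ K') (m : ℕ) : ∀ a : ℝ, 0 < a → K' + m ≤ D →
    ∃ c : ℝ, 0 < c ∧
      ∀ (F V : Type) [Field F] [Fintype F] [AddCommGroup V] [Module F V] [Fintype V]
        (β : ℝ) (H : Submodule F V) (L S : Finset (Submodule F V)), β ≤ K' →
        (∀ W ∈ L, finrank F W = K' + m ∧ ¬ W ≤ H) →
        (∀ U : Submodule F V, finrank F U = K' → ¬ U ≤ H → (∃ W ∈ L, U ≤ W) → U ∈ S) →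
        a * (Fintype.card F : ℝ) ^ (((K' + m : ℕ) : ℝ) * (D - (K' + m : ℕ)) + β) ≤ #L →
        c * (Fintype.card F : ℝ) ^ ((K' : ℝ) * (D - K') + β) ≤ #S := by
  induction m with
  | zero =>
    intro a ha _
    refine ⟨a, ha, ?_⟩
    intro F V _ _ _ _ _ β H L S _ hL hS h
    refine h.trans (mod_cast card_le_card fun W hW => ?_)
    exact hS W (hL W hW).1 (hL W hW).2 ⟨W, hW, le_rfl⟩
  | succ m ih =>
    intro a ha hD
    obtain ⟨c₁, hc₁, hstep⟩ := card_shadow_ge (K' + m) (D - (K' + m + 1)) (by omega)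
    obtain ⟨c, hc, h⟩ := ih (min (c₁ * a) c₁) (by positivity) (by omega)
    refine ⟨c, hc, ?_⟩
    intro F V _ _ _ _ _ β H L S hβ hL hS hcard
    have : Fintype (Submodule F V) := Fintype.ofFinite _
    set L' : Finset (Submodule F V) :=
      univ.filter fun U => finrank F U = K' + m ∧ ¬ U ≤ H ∧ ∃ W ∈ L, U ≤ W with hL'
    have hstep' := hstep F V H L L' hL fun U hU hUH hUL =>
      mem_filter.2 ⟨mem_univ _, hU, hUH, hUL⟩
    refine h F V β H L' S hβ (fun W hW => ?_) (fun U hU hUH hUL => ?_) ?_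
    · exact ⟨(mem_filter.1 hW).2.1, (mem_filter.1 hW).2.2.1⟩
    · obtain ⟨W', hW', hUW'⟩ := hUL
      obtain ⟨W, hW, hWW⟩ := (mem_filter.1 hW').2.2.2
      exact hS U hU hUH ⟨W, hW, hUW'.trans hWW⟩
    · refine rpow_le_card_of_step (by omega) (by linarith [two_le_card_field (F := F)]) hc₁
        (hβ.trans (by push_cast; linarith [m.cast_nonneg (α := ℝ)])) ?_ hstep'
      convert hcard using 4
      push_cast
      ring

end Iterate

section Cone

open Module

variable {F V : Type} [Field F] [AddCommGroup V] [Module F V]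

/-- The slice at height `1` of a subspace of `F × V`. -/
def affineSlice (U : Submodule F (F × V)) : Set V := {a | ((1 : F), a) ∈ U}

/-- The subspace of `F × V` spanned by the copy at height `1` of the affine subspace `x + W`. -/
def affineCone (x : V) (W : Submodule F V) : Submodule F (F × V) :=
  W.comap (LinearMap.snd F F V - (LinearMap.fst F F V).smulRight x)

lemma mem_affineCone {x : V} {W : Submodule F V} {z : F × V} :
    z ∈ affineCone x W ↔ z.2 - z.1 • x ∈ W := Iff.rfl

lemma affineSlice_affineCone (x : V) (W : Submodule F V) :
    affineSlice (affineCone x W) = x +ᵥ (W : Set V) := by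
  ext a
  rw [Set.mem_vadd_set_iff_neg_vadd_mem]
  change a - (1 : F) • x ∈ W ↔ -x + a ∈ W
  rw [one_smul, sub_eq_neg_add]

lemma finrank_affineCone [FiniteDimensional F V] (x : V) (W : Submodule F V) :
    finrank F (affineCone x W) = finrank F W + 1 := by
  let e : (F × W) ≃ₗ[F] affineCone x W :=
    { toFun := fun z => ⟨(z.1, z.1 • x + z.2), by rw [mem_affineCone]; simp⟩
      map_add' := fun z z' => by
        ext
        · simp
        · simp only [Prod.fst_add, Prod.snd_add, Submodule.coe_add, add_smul]
          abel
      map_smul' := fun t z => by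
        ext <;> simp [mul_smul]
      invFun := fun z => (z.1.1, ⟨z.1.2 - z.1.1 • x, z.2⟩)
      left_inv := fun z => by ext <;> simp
      right_inv := fun z => by ext <;> simp }
  rw [← e.finrank_eq, finrank_prod, finrank_self, add_comm]

lemma affineCone_not_le_ker_fst (x : V) (W : Submodule F V) :
    ¬ affineCone x W ≤ LinearMap.ker (LinearMap.fst F F V) := fun h => by
  have hx : ((1 : F), x) ∈ affineCone x W := by rw [mem_affineCone]; simp
  simpa using h hx

lemma exists_eq_affineCone {U : Submodule F (F × V)}
    (hU : ¬ U ≤ LinearMap.ker (LinearMap.fst F F V)) : ∃ x W, U = affineCone x W := by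
  obtain ⟨⟨t, v⟩, hz, ht⟩ := SetLike.not_le_iff_exists.1 hU
  have ht0 : t ≠ 0 := by simpa using ht
  have hx : ((1 : F), t⁻¹ • v) ∈ U := by
    have := U.smul_mem t⁻¹ hz
    simpa [ht0] using this
  refine ⟨t⁻¹ • v, U.comap (LinearMap.inr F F V), ?_⟩
  ext ⟨s, w⟩
  rw [mem_affineCone, Submodule.mem_comap]
  have hsw : ((s, w) : F × V) =
      LinearMap.inr F F V (w - s • t⁻¹ • v) + s • ((1 : F), t⁻¹ • v) := by
    ext <;> simp
  constructor
  · intro h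
    have := U.sub_mem h (U.smul_mem s hx)
    rwa [hsw, add_sub_cancel_right] at this
  · intro h
    rw [hsw]
    exact U.add_mem h (U.smul_mem s hx)

lemma affineCone_le_iff {x : V} {W : Submodule F V} {U : Submodule F (F × V)} :
    affineCone x W ≤ U ↔ x +ᵥ (W : Set V) ⊆ affineSlice U := by
  rw [← affineSlice_affineCone]
  refine ⟨fun h a ha => h ha, fun h => ?_⟩
  have h1 : ∀ z ∈ affineCone x W, z.1 ≠ 0 → z ∈ U := by
    intro z hz hz0
    have h2 : ((1 : F), z.1⁻¹ • z.2) ∈ affineCone x W := by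
      have := (affineCone x W).smul_mem z.1⁻¹ hz
      rwa [Prod.smul_def, smul_eq_mul, inv_mul_cancel₀ hz0] at this
    have h3 := U.smul_mem z.1 (h h2)
    rwa [Prod.smul_mk, smul_eq_mul, mul_one, smul_smul, mul_inv_cancel₀ hz0, one_smul] at h3
  intro z hz
  have hx : ((1 : F), x) ∈ affineCone x W := by rw [mem_affineCone]; simp
  by_cases hz0 : z.1 = 0
  · have h4 := h1 (z + (1, x)) ((affineCone x W).add_mem hz hx) (by simp [hz0])
    have h5 := h1 (1, x) hx one_ne_zero
    simpa using U.sub_mem h4 h5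
  · exact h1 z hz hz0

lemma affineSlice_injOn : Set.InjOn (affineSlice (F := F) (V := V))
    {U | ¬ U ≤ LinearMap.ker (LinearMap.fst F F V)} := by
  intro U hU U' hU' h
  obtain ⟨x, W, rfl⟩ := exists_eq_affineCone hU
  obtain ⟨x', W', rfl⟩ := exists_eq_affineCone hU'
  refine le_antisymm ?_ ?_
  · rw [affineCone_le_iff, ← h, affineSlice_affineCone]
  · rw [affineCone_le_iff, h, affineSlice_affineCone]

lemma affineSlice_isPlane [FiniteDimensional F V] {U : Submodule F (F × V)} {k : ℕ}
    (hU : ¬ U ≤ LinearMap.ker (LinearMap.fst F F V)) (hk : finrank F U = k + 1) :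
    IsPlane F k (affineSlice U) := by
  obtain ⟨x, W, rfl⟩ := exists_eq_affineCone hU
  rw [finrank_affineCone] at hk
  exact ⟨x, W, by omega, affineSlice_affineCone x W⟩

lemma exists_affineSlice_eq [FiniteDimensional F V] {A : Set V} {k : ℕ} (hA : IsPlane F k A) :
    ∃ U : Submodule F (F × V), ¬ U ≤ LinearMap.ker (LinearMap.fst F F V) ∧
      finrank F U = k + 1 ∧ affineSlice U = A := by
  obtain ⟨x, W, hW, rfl⟩ := hA
  exact ⟨affineCone x W, affineCone_not_le_ker_fst x W, by rw [finrank_affineCone, hW],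
    affineSlice_affineCone x W⟩

end Cone

open Finset in
open scoped Classical in
/-- **Theorem 6 (k'-planes contained in a family of k-planes).** -/
theorem subplanes_of_kplanes_lower_bound (d k k' : ℕ) (hk' : k' < k) (hkd : k ≤ d) :
    ∃ c : ℝ, 0 < c ∧
      ∀ (F : Type) [Field F] [Fintype F] (n : ℕ)
        (β : ℝ), 0 ≤ β → β ≤ (k' : ℝ) + 1 →
        ∀ L : Set (Set (Fin n → F)),
          (∀ ℓ ∈ L, IsPlane F k ℓ) →
          (L.ncard : ℝ) ≥ (Fintype.card F : ℝ) ^ (((k : ℝ) + 1) * ((d : ℝ) - k) + β) →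
          ({P : Set (Fin n → F) | IsPlane F k' P ∧ ∃ ℓ ∈ L, P ⊆ ℓ}.ncard : ℝ) ≥
            c * (Fintype.card F : ℝ) ^ (((k' : ℝ) + 1) * ((d : ℝ) - k') + β) := by
  obtain ⟨c, hc, h⟩ := rpow_le_card_shadow (d + 1) (k' + 1) (by omega) (k - k') 1 one_pos
    (by omega)
  refine ⟨c, hc, ?_⟩
  intro F _ _ n β _ hβ L hL hcard
  have : Fintype (Submodule F (F × (Fin n → F))) := Fintype.ofFinite _
  have hkk : ((k' + 1 + (k - k') : ℕ) : ℝ) = k + 1 := by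
    rw [show k' + 1 + (k - k') = k + 1 by omega]
    push_cast
    ring
  set H := LinearMap.ker (LinearMap.fst F F (Fin n → F))
  set 𝓛 : Finset (Submodule F (F × (Fin n → F))) :=
    univ.filter fun W => ¬ W ≤ H ∧ Module.finrank F W = k + 1 ∧ affineSlice W ∈ L with h𝓛
  set 𝓢 : Finset (Submodule F (F × (Fin n → F))) :=
    univ.filter fun U => ¬ U ≤ H ∧ Module.finrank F U = k' + 1 ∧ ∃ W ∈ 𝓛, U ≤ W with h𝓢
  have h𝓛card : L.ncard ≤ #𝓛 := by
    rw [← Set.ncard_coe_finset]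
    refine (Set.ncard_le_ncard (t := affineSlice '' (𝓛 : Set (Submodule F (F × (Fin n → F)))))
      fun A hA => ?_).trans (Set.ncard_image_le)
    obtain ⟨U, hUH, hUk, rfl⟩ := exists_affineSlice_eq (hL A hA)
    exact ⟨U, mem_coe.2 (mem_filter.2 ⟨mem_univ _, hUH, hUk, hA⟩), rfl⟩
  have h𝓢card : #𝓢 ≤ {P : Set (Fin n → F) | IsPlane F k' P ∧ ∃ ℓ ∈ L, P ⊆ ℓ}.ncard := by
    rw [← Set.ncard_coe_finset]
    refine Set.ncard_le_ncard_of_injOn affineSlice (fun U hU => ?_)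
      (affineSlice_injOn.mono fun U hU => (mem_filter.1 (mem_coe.1 hU)).2.1)
    obtain ⟨-, hUH, hUk, W, hW, hUW⟩ := mem_filter.1 (mem_coe.1 hU)
    exact ⟨affineSlice_isPlane hUH hUk, _, (mem_filter.1 hW).2.2.2, fun a ha => hUW ha⟩
  have hmain := h F (F × (Fin n → F)) β H 𝓛 𝓢 (by push_cast; exact hβ)
    (fun W hW => ⟨?_, (mem_filter.1 hW).2.1⟩)
    (fun U hU hUH hUL => mem_filter.2 ⟨mem_univ _, hUH, hU, hUL⟩) ?_
  · refine ge_iff_le.2 (le_trans (le_of_eq ?_) (hmain.trans (mod_cast h𝓢card)))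
    congr 3
    push_cast
    ring
  · rw [(mem_filter.1 hW).2.2.1]
    omega
  · refine le_trans (le_of_eq ?_) (ge_iff_le.1 (hcard.le.trans (mod_cast h𝓛card)))
    rw [one_mul, hkk]
    congr 2
    push_cast
    ring
end
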